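/- arXiv:1703.05553 — 6 statements merged into one kernel-verified Lean document; each statement's English description precedes it below -/
import Mathlib

section
/- Let H be a finitely generated group admitting a faithful representation into GL(d,F), for some positive integer d and field F, with NIU-linear image, and let A be a central subgroup of H isomorphic to ℤⁿ for some n ≥ 1. Then there exists a finite index subgroup K of H containing A, together with a normal subgroup N of K, such that N ∩ A = {1} and K = NA; that is, K is the internal direct product of N and A, so A is a direct factor of K. -/
open Matrix

/-- `M ∈ GL(d,F)` is unipotent if `(M - I)^d = 0`. -/
def IsUnipotent {d : ℕ} {F : Type} [Field F] (M : GL (Fin d) F) : Prop :=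
  ((M : Matrix (Fin d) (Fin d) F) - 1) ^ d = 0

/-- A submodule of a f.g. abelian group is virtually a direct summand. -/
lemma exists_virtual_complement {B : Type} [AddCommGroup B] [Module.Finite ℤ B]
    (A : Submodule ℤ B) :
    ∃ C : Submodule ℤ B, C ⊓ A = ⊥ ∧ Finite (B ⧸ (A ⊔ C)) := by
  let Q := B ⧸ A
  let P := Q ⧸ Submodule.torsion ℤ Q
  let π : B →ₗ[ℤ] P := (Submodule.mkQ (Submodule.torsion ℤ Q)).comp A.mkQ
  have hπ : Function.Surjective π :=
    (Submodule.mkQ_surjective _).comp (Submodule.mkQ_surjective _)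
  have : Module.Free ℤ P := inferInstance
  obtain ⟨s, hs⟩ := LinearMap.exists_rightInverse_of_surjective π (LinearMap.range_eq_top.2 hπ)
  have hs' : ∀ p, π (s p) = p := fun p => LinearMap.congr_fun hs p
  have hA : ∀ a ∈ A, π a = 0 := by
    intro a ha
    have : A.mkQ a = 0 := by simpa using ha
    simp only [π, LinearMap.comp_apply, this, map_zero]
  refine ⟨LinearMap.range s, ?_, ?_⟩
  · rw [eq_bot_iff]
    rintro x ⟨⟨p, rfl⟩, hx⟩
    have := hA _ hx
    rw [hs'] at this
    simp [this]
  · apply Module.finite_of_fg_torsion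
    intro x
    obtain ⟨b, rfl⟩ := Submodule.mkQ_surjective _ x
    have h0 : π (b - s (π b)) = 0 := by rw [map_sub, hs', sub_self]
    have h1 : A.mkQ (b - s (π b)) ∈ Submodule.torsion ℤ Q := by
      exact (Submodule.Quotient.mk_eq_zero _).1 h0
    obtain ⟨m, hm⟩ := (Submodule.mem_torsion_iff _).1 h1
    refine ⟨m, ?_⟩
    change (m : ℤ) • (A.mkQ (b - s (π b))) = 0 at hm
    change (m : ℤ) • (Submodule.mkQ (A ⊔ LinearMap.range s) b) = 0
    rw [← map_smul, Submodule.mkQ_apply, Submodule.Quotient.mk_eq_zero] at hm ⊢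
    rw [smul_sub] at hm
    have : (m : ℤ) • b = ((m : ℤ) • b - (m : ℤ) • s (π b)) + (m : ℤ) • s (π b) := by abel
    rw [this]
    exact Submodule.add_mem_sup hm (Submodule.smul_mem _ _ ⟨_, rfl⟩)

lemma exists_virtual_complement_mul {B : Type} [CommGroup B] (hB : Group.FG B)
    (A : Subgroup B) :
    ∃ C : Subgroup B, C ⊓ A = ⊥ ∧ (A ⊔ C).FiniteIndex := by
  have : Module.Finite ℤ (Additive B) :=
    Module.Finite.iff_addGroup_fg.2 (GroupFG.iff_add_fg.1 hB)
  obtain ⟨C, h1, h2⟩ := exists_virtual_complement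
    (AddSubgroup.toIntSubmodule (Subgroup.toAddSubgroup A))
  let C' : Subgroup B := Subgroup.toAddSubgroup.symm (C.toAddSubgroup)
  have hC : ∀ x, x ∈ C' ↔ Additive.ofMul x ∈ C := fun x => Iff.rfl
  refine ⟨C', ?_, ?_⟩
  · rw [eq_bot_iff]
    rintro x ⟨hx1, hx2⟩
    have : Additive.ofMul x ∈ (⊥ : Submodule ℤ (Additive B)) := by
      rw [← h1]; exact ⟨hx1, hx2⟩
    exact this
  · have hf : (((AddSubgroup.toIntSubmodule (Subgroup.toAddSubgroup A)) ⊔ C).toAddSubgroup).FiniteIndex :=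
      AddSubgroup.finiteIndex_iff_finite_quotient.2 h2
    have e : Subgroup.toAddSubgroup (A ⊔ C') =
      ((AddSubgroup.toIntSubmodule (Subgroup.toAddSubgroup A)) ⊔ C).toAddSubgroup := by
      rw [Submodule.sup_toAddSubgroup, OrderIso.map_sup]
      rfl
    rw [← e] at hf
    constructor
    have := hf.index_ne_zero
    rwa [Subgroup.index_toAddSubgroup] at this

lemma det_of_sub_nilp {K V : Type} [Field K] [AddCommGroup V] [Module K V]
    [FiniteDimensional K V] (f : Module.End K V) (μ : K)
    (h : IsNilpotent (f - algebraMap K _ μ)) :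
    LinearMap.det f = μ ^ Module.finrank K V := by
  have h2 : IsNilpotent (algebraMap K _ μ - f) := by
    rw [← neg_sub]; exact h.neg
  have h1 := h2.charpoly_eq_X_pow_finrank
  have h3 := LinearMap.eval_charpoly (algebraMap K (Module.End K V) μ - f) μ
  rw [h1, sub_sub_cancel] at h3
  simpa using h3.symm

/-- Key fact on linear maps over an algebraically closed field. -/
lemma key {H K V : Type} [Group H] [Field K] [IsAlgClosed K] [AddCommGroup V] [Module K V]
    [FiniteDimensional K V] (ρ : H →* Module.End K V) (a : H) (ha : a ∈ Subgroup.center H)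
    (hc : a ∈ commutator H) :
    (ρ a ^ (Module.finrank K V).factorial - 1) ^ (Module.finrank K V) = 0 := by
  set f := ρ a with hf
  have hcomm : ∀ h, Commute f (ρ h) := by
    intro h
    have := Subgroup.mem_center_iff.1 ha h
    change ρ a * ρ h = ρ h * ρ a
    rw [← map_mul, ← map_mul, this]
  have hker : ∀ μ, f.maxGenEigenspace μ ≤ LinearMap.ker
      ((f ^ (Module.finrank K V).factorial - 1) ^ (Module.finrank K V)) := by
    intro μ
    by_cases hbot : f.maxGenEigenspace μ = ⊥
    · rw [hbot]; exact bot_le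
    let φ : H →* K :=
      { toFun := fun h => LinearMap.det
          ((ρ h).restrict (f.mapsTo_maxGenEigenspace_of_comm (hcomm h) μ))
        map_one' := by
          convert LinearMap.det_id
          ext x
          simp [LinearMap.restrict_apply]
        map_mul' := by
          intro x y
          rw [← map_mul]
          congr 1
          ext v
          simp only [LinearMap.restrict_apply, map_mul, Module.End.mul_apply]
          rfl }
    have hφ : φ a = 1 := by
      have := Abelianization.commutator_subset_ker φ.toHomUnits hc
      rw [MonoidHom.mem_ker] at this
      have := congrArg Units.val this
      simpa using this
    have hdet : φ a = μ ^ Module.finrank K (f.maxGenEigenspace μ) := by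
      apply det_of_sub_nilp
      exact f.isNilpotent_restrict_maxGenEigenspace_sub_algebraMap μ
    have hμ : μ ^ (Module.finrank K V).factorial = 1 := by
      have hpos : 0 < Module.finrank K (f.maxGenEigenspace μ) :=
        Nat.pos_of_ne_zero (fun h => hbot (Submodule.finrank_eq_zero.1 h))
      obtain ⟨c, hc⟩ := Nat.dvd_factorial hpos (Submodule.finrank_le (f.maxGenEigenspace μ))
      rw [hc, pow_mul, ← hdet, hφ, one_pow]
    have hdvd : ∃ g, f ^ (Module.finrank K V).factorial - 1 = g * (f - algebraMap K _ μ) ∧ 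
        Commute g (f - algebraMap K _ μ) := by
      have hr : (Polynomial.X ^ (Module.finrank K V).factorial - 1 : Polynomial K).IsRoot μ := by
        simp [hμ]
      obtain ⟨q, hq⟩ := Polynomial.dvd_iff_isRoot.2 hr
      have h1 : Polynomial.aeval f (Polynomial.X - Polynomial.C μ) = f - algebraMap K _ μ := by
        simp
      refine ⟨Polynomial.aeval f q, ?_, ?_⟩
      · rw [← h1, ← map_mul, mul_comm, ← hq]
        simp
      · rw [← h1]
        exact (Commute.all q _).map (Polynomial.aeval f)
    obtain ⟨g, hg, hgc⟩ := hdvd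
    intro v hv
    rw [Module.End.maxGenEigenspace_eq_genEigenspace_finrank] at hv
    rw [Module.End.mem_genEigenspace_nat] at hv
    rw [hg, hgc.mul_pow, LinearMap.mem_ker, Module.End.mul_apply]
    rw [LinearMap.mem_ker] at hv
    change (g ^ _) (((f - μ • (1 : Module.End K V)) ^ (Module.finrank K V)) v) = 0
    rw [hv, map_zero]
  rw [← LinearMap.ker_eq_top, eq_top_iff, ← Module.End.iSup_maxGenEigenspace_eq_top f]
  exact iSup_le hker

theorem stmt_8 {H : Type} [Group H] (hfg : Group.FG H)
    {d : ℕ} (hd : 0 < d) {F : Type} [Field F]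
    (hlin : ∃ ρ : H →* GL (Fin d) F, Function.Injective ρ ∧
      ∀ g ∈ ρ.range, IsUnipotent g → IsOfFinOrder g)
    (n : ℕ) (hn : 1 ≤ n) (A : Subgroup H) (hcentral : A ≤ Subgroup.center H)
    (hiso : Nonempty (↥A ≃* Multiplicative (Fin n → ℤ))) :
    ∃ K : Subgroup H, K.FiniteIndex ∧ A ≤ K ∧
      ∃ N : Subgroup H, N ≤ K ∧ (∀ k ∈ K, ∀ x ∈ N, k * x * k⁻¹ ∈ N) ∧
        N ⊓ A = ⊥ ∧ ∀ k ∈ K, ∃ x ∈ N, ∃ a ∈ A, k = x * a := by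
  obtain ⟨ρ, hinj, hniu⟩ := hlin
  obtain ⟨e⟩ := hiso
  have htf : ∀ a ∈ A, ∀ m : ℕ, 0 < m → a ^ m = 1 → a = 1 := by
    intro a ha m hm h
    have h1 : (⟨a, ha⟩ : A) ^ m = 1 := Subtype.ext h
    have h2 : (e ⟨a, ha⟩) ^ m = 1 := by rw [← map_pow, h1, map_one]
    have h3 : m • (Multiplicative.toAdd (e ⟨a, ha⟩)) = 0 := congrArg Multiplicative.toAdd h2
    have h4 : Multiplicative.toAdd (e ⟨a, ha⟩) = 0 := by
      rcases smul_eq_zero.1 h3 with h | h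
      · omega
      · exact h
    have h5 : e ⟨a, ha⟩ = 1 := h4
    have h6 : (⟨a, ha⟩ : A) = 1 := by simpa using h5
    exact congrArg Subtype.val h6
  have hcomm : ∀ a ∈ A, a ∈ commutator H → a = 1 := by
    intro a ha hc
    let Fb := AlgebraicClosure F
    let σ : Matrix (Fin d) (Fin d) F →+* Matrix (Fin d) (Fin d) Fb :=
      (algebraMap F Fb).mapMatrix
    let r : H →* Module.End Fb (Fin d → Fb) :=
      (MonoidHomClass.toMonoidHom
        (Matrix.toLinAlgEquiv' : Matrix (Fin d) (Fin d) Fb ≃ₐ[Fb] _)).comp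
        (σ.toMonoidHom.comp ((Units.coeHom _).comp ρ))
    have hk := key r a (hcentral ha) hc
    rw [Module.finrank_fin_fun] at hk
    have hr : r a = Matrix.toLinAlgEquiv' (σ (ρ a : Matrix (Fin d) (Fin d) F)) := rfl
    rw [hr, ← map_pow, ← map_pow, ← map_one (Matrix.toLinAlgEquiv'), ← map_one σ, ← map_sub,
      ← map_sub, ← map_pow, ← map_pow] at hk
    have h1 := (map_eq_zero_iff _ (Matrix.toLinAlgEquiv' (R := Fb) (n := Fin d)).injective).1 hk
    have h2 := (map_eq_zero_iff σ
      (Matrix.map_injective (algebraMap F Fb).injective)).1 h1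
    have h3 : IsUnipotent (ρ (a ^ d.factorial)) := by
      unfold IsUnipotent
      rw [map_pow]
      exact h2
    have h4 := hniu _ ⟨_, rfl⟩ h3
    obtain ⟨m, hm, h5⟩ := isOfFinOrder_iff_pow_eq_one.1 h4
    rw [← map_pow, ← map_one ρ, hinj.eq_iff, ← pow_mul] at h5
    exact htf a ha _ (Nat.mul_pos (Nat.factorial_pos _) hm) h5
  have hBfg : Group.FG (Abelianization H) :=
    Group.fg_of_surjective (f := (Abelianization.of : H →* _)) (QuotientGroup.mk_surjective)
  obtain ⟨C, hC1, hC2⟩ := exists_virtual_complement_mul hBfg (A.map Abelianization.of)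
  refine ⟨(A.map Abelianization.of ⊔ C).comap Abelianization.of, ?_, ?_,
    C.comap Abelianization.of, Subgroup.comap_mono le_sup_right, ?_, ?_, ?_⟩
  · constructor
    rw [Subgroup.index_comap_of_surjective _ QuotientGroup.mk_surjective]
    exact hC2.index_ne_zero
  · exact Subgroup.map_le_iff_le_comap.1 le_sup_left
  · intro k _ x hx
    rw [Subgroup.mem_comap] at hx ⊢
    simpa [mul_comm] using hx
  · rw [eq_bot_iff]
    rintro x ⟨hx1, hx2⟩
    have h : Abelianization.of x ∈ C ⊓ A.map Abelianization.of := ⟨hx1, x, hx2, rfl⟩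
    rw [hC1, Subgroup.mem_bot] at h
    refine hcomm x hx2 ?_
    rwa [← MonoidHom.mem_ker, Abelianization.ker_of] at h
  · intro k hk
    rw [Subgroup.mem_comap, Subgroup.mem_sup] at hk
    obtain ⟨_, ⟨a, ha, rfl⟩, c, hc, h⟩ := hk
    refine ⟨k * a⁻¹, ?_, a, ha, by group⟩
    rw [Subgroup.mem_comap, map_mul, map_inv, ← h]
    simpa using hc
end

section
/- Let S be a solvable subgroup of GL(d,F) for some field F and positive integer d. Then S possesses a finite index subgroup T which is nilpotent-by-abelian: there is a normal subgroup N of T such that N is nilpotent and T/N is abelian. -/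
open Matrix

namespace MalcevAux
open scoped commutatorElement

lemma finiteIndex_of_map {G α : Type*} [Group G] (H : Subgroup G) (f : G → α)
    (hf : (Set.range f).Finite) (h : ∀ x y, f x = f y → x⁻¹ * y ∈ H) : H.FiniteIndex := by
  have : Finite (Set.range f) := hf
  have : Finite (G ⧸ H) := by
    refine Finite.of_injective (fun q : G ⧸ H => (⟨f q.out, q.out, rfl⟩ : Set.range f)) ?_
    intro p q hpq
    have h1 : f p.out = f q.out := congrArg Subtype.val hpq
    have h2 := h _ _ h1
    rw [← QuotientGroup.eq] at h2
    simpa using h2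
  exact Subgroup.finiteIndex_of_finite_quotient

variable {K : Type*} [Field K] {V : Type*} [AddCommGroup V] [Module K V]
variable {G : Type*} [Group G]

lemma rho_inv_apply (ρ : G →* Module.End K V) (g : G) (v : V) : ρ g⁻¹ (ρ g v) = v := by
  rw [← Module.End.mul_apply, ← map_mul]; simp

lemma rho_apply_inv (ρ : G →* Module.End K V) (g : G) (v : V) : ρ g (ρ g⁻¹ v) = v := by
  rw [← Module.End.mul_apply, ← map_mul]; simp

lemma rho_inv_mul (ρ : G →* Module.End K V) (g : G) : ρ g⁻¹ * ρ g = 1 := by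
  rw [← map_mul]; simp

lemma rho_mul_inv (ρ : G →* Module.End K V) (g : G) : ρ g * ρ g⁻¹ = 1 := by
  rw [← map_mul]; simp

/-- All finite index subgroups act irreducibly. -/
def StrIrr (ρ : G →* Module.End K V) : Prop :=
  ∀ H : Subgroup G, H.FiniteIndex → ∀ W : Submodule K V, W ≠ ⊥ →
    (∀ h ∈ H, ∀ w ∈ W, ρ h w ∈ W) → W = ⊤

/-- A normal subgroup acting by scalars. -/
def Scal (ρ : G →* Module.End K V) (x : G) : Prop := ∃ μ : K, ∀ v, ρ x v = μ • v

variable [IsAlgClosed K] [FiniteDimensional K V] [Nontrivial V]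

lemma scal_of_finite_orbit {ρ : G →* Module.End K V} (hρ : StrIrr ρ) (a : G)
    (hfin : (Set.range fun g => ρ (g * a * g⁻¹)).Finite) : Scal ρ a := by
  obtain ⟨μ, hμ⟩ := Module.End.exists_eigenvalue (ρ a)
  let H : Subgroup G := (Subgroup.centralizer {ρ.toHomUnits a}).comap ρ.toHomUnits
  have hmem : ∀ x, x ∈ H ↔ ρ a * ρ x = ρ x * ρ a := by
    intro x
    simp only [H, Subgroup.mem_comap, Subgroup.mem_centralizer_iff, Set.mem_singleton_iff,
      forall_eq]
    simp only [Units.ext_iff, Units.val_mul, MonoidHom.coe_toHomUnits]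
  have hH : H.FiniteIndex := by
    refine finiteIndex_of_map H _ hfin ?_
    intro x y hxy
    have hxy' : ρ (x * a * x⁻¹) = ρ (y * a * y⁻¹) := hxy
    rw [hmem, ← map_mul, ← map_mul]
    have e1 : a * (x⁻¹ * y) = x⁻¹ * (x * a * x⁻¹) * y := by group
    have e2 : x⁻¹ * y * a = x⁻¹ * (y * a * y⁻¹) * y := by group
    rw [e1, e2, map_mul, map_mul, map_mul _ _ y, map_mul _ x⁻¹ (y * a * y⁻¹), hxy']
  have := hρ H hH ((ρ a).eigenspace μ) hμ (by
    intro h hh w hw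
    rw [Module.End.mem_eigenspace_iff] at hw ⊢
    rw [← Module.End.mul_apply, (hmem h).1 hh, Module.End.mul_apply, hw, map_smul])
  refine ⟨μ, fun v => ?_⟩
  have hv : v ∈ (ρ a).eigenspace μ := by rw [this]; trivial
  exact Module.End.mem_eigenspace_iff.1 hv

lemma exists_common_eigen {ι : Type*} (f : ι → Module.End K V)
    (hf : ∀ i j, Commute (f i) (f j)) :
    ∃ χ : ι → K, (⨅ i, (f i).eigenspace (χ i)) ≠ ⊥ := by
  obtain ⟨U, ⟨hU0, hUinv⟩, hmin⟩ := (wellFounded_lt (α := Submodule K V)).has_min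
    {U | U ≠ ⊥ ∧ ∀ i, ∀ u ∈ U, f i u ∈ U} ⟨⊤, top_ne_bot, by simp⟩
  have key : ∀ i, ∃ μ : K, U ≤ (f i).eigenspace μ := by
    intro i
    have : Nontrivial U := Submodule.nontrivial_iff_ne_bot.2 hU0
    obtain ⟨μ, hμ⟩ := Module.End.exists_eigenvalue ((f i).restrict (hUinv i))
    obtain ⟨u, hu, hu0⟩ := hμ.exists_hasEigenvector
    refine ⟨μ, ?_⟩
    by_contra hle
    refine hmin (U ⊓ (f i).eigenspace μ) ⟨?_, ?_⟩ (inf_lt_left.2 hle)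
    · intro hbot
      apply hu0
      have : (u : V) ∈ U ⊓ (f i).eigenspace μ := by
        refine ⟨u.2, ?_⟩
        have := Module.End.mem_eigenspace_iff.1 hu
        exact Module.End.mem_eigenspace_iff.2 (congrArg Subtype.val this)
      rw [hbot] at this
      exact Subtype.ext ((Submodule.mem_bot K).1 this)
    · rintro j w ⟨hw1, hw2⟩
      refine ⟨hUinv j w hw1, ?_⟩
      have hw2 := Module.End.mem_eigenspace_iff.1 hw2
      refine Module.End.mem_eigenspace_iff.2 ?_
      rw [← Module.End.mul_apply, (hf i j).eq, Module.End.mul_apply, hw2, map_smul]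
  choose χ hχ using key
  exact ⟨χ, fun h => hU0 (le_bot_iff.1 (h ▸ le_iInf hχ))⟩

lemma finite_weights {ι : Type*} (f : ι → Module.End K V)
    (hf : ∀ i j, Commute (f i) (f j)) :
    {χ : ι → K | (⨅ i, (f i).eigenspace (χ i)) ≠ ⊥}.Finite := by
  apply WellFoundedGT.finite_ne_bot_of_iSupIndep
  have := Module.End.independent_iInf_maxGenEigenspace_of_forall_mapsTo f
    (fun i j φ => Module.End.mapsTo_maxGenEigenspace_of_comm (hf j i) φ)
  refine this.mono fun χ => iInf_mono fun i => ?_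
  exact (f i).genEigenspace_le_maximal (χ i) 1

lemma scal_of_comm {ρ : G →* Module.End K V} (hρ : StrIrr ρ) (A : Subgroup G) (hA : A.Normal)
    (hcomm : ∀ x ∈ A, ∀ y ∈ A, Commute (ρ x) (ρ y)) : ∀ a ∈ A, Scal ρ a := by
  let f : A → Module.End K V := fun a => ρ a
  have hf : ∀ i j, Commute (f i) (f j) := fun i j => hcomm _ i.2 _ j.2
  obtain ⟨χ, hχ⟩ := exists_common_eigen f hf
  let E : (A → K) → Submodule K V := fun χ => ⨅ i, (f i).eigenspace (χ i)
  have memE : ∀ χ v, v ∈ E χ ↔ ∀ a : A, ρ a v = χ a • v := by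
    intro χ v
    simp [E, f, Submodule.mem_iInf]
  let φ : G → Submodule K V := fun g => (E χ).map (ρ g)
  have hφ : (Set.range φ).Finite := by
    refine ((finite_weights f hf).image E).subset ?_
    rintro _ ⟨g, rfl⟩
    have hconj : ∀ a : A, g⁻¹ * a * g ∈ A := fun a => by
      simpa using hA.conj_mem a a.2 g⁻¹
    have hconj' : ∀ a : A, g * a * g⁻¹ ∈ A := fun a => hA.conj_mem a a.2 g
    have heq : φ g = E (fun a => χ ⟨g⁻¹ * a * g, hconj a⟩) := by
      ext v
      rw [memE]
      constructor
      · rintro ⟨w, hw, rfl⟩ a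
        have := (memE _ _).1 hw ⟨g⁻¹ * a * g, hconj a⟩
        rw [← map_smul, ← this, ← Module.End.mul_apply, ← Module.End.mul_apply, ← map_mul,
          ← map_mul]
        congr 2; group
      · intro h
        refine ⟨ρ g⁻¹ v, ?_, rho_apply_inv ρ g v⟩
        refine (memE _ _).2 fun a => ?_
        have := h ⟨g * a * g⁻¹, hconj' a⟩
        have e : (⟨g⁻¹ * (g * a * g⁻¹) * g, hconj ⟨g * a * g⁻¹, hconj' a⟩⟩ : A) = a := by
          apply Subtype.ext; simp [mul_assoc]
        simp only [e] at this
        rw [← map_smul, ← this, ← Module.End.mul_apply, ← Module.End.mul_apply, ← map_mul,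
          ← map_mul]
        congr 2; group
    refine ⟨_, ?_, heq.symm⟩
    change E _ ≠ ⊥
    rw [← heq]
    intro hbot
    apply hχ
    rw [eq_bot_iff]
    intro w hw
    have : ρ g w ∈ φ g := ⟨w, hw, rfl⟩
    rw [hbot, Submodule.mem_bot] at this
    rw [Submodule.mem_bot, ← rho_inv_apply ρ g w, this, map_zero]
  let H : Subgroup G :=
    { carrier := {g | φ g = E χ}
      one_mem' := by
        change (E χ).map (ρ 1) = E χ
        rw [map_one]; exact Submodule.map_id _
      mul_mem' := by
        intro a b ha hb
        change (E χ).map (ρ a) = E χ at ha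
        change (E χ).map (ρ b) = E χ at hb
        change (E χ).map (ρ (a * b)) = E χ
        rw [map_mul, Module.End.mul_eq_comp, Submodule.map_comp, hb, ha]
      inv_mem' := by
        intro a ha
        change (E χ).map (ρ a) = E χ at ha
        change (E χ).map (ρ a⁻¹) = E χ
        conv_lhs => rw [← ha]
        rw [← Submodule.map_comp, ← Module.End.mul_eq_comp, rho_inv_mul]
        exact Submodule.map_id _ }
  have hH : H.FiniteIndex := by
    refine finiteIndex_of_map H φ hφ ?_
    intro x y hxy
    change (E χ).map (ρ x) = (E χ).map (ρ y) at hxy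
    change (E χ).map (ρ (x⁻¹ * y)) = E χ
    rw [map_mul, Module.End.mul_eq_comp, Submodule.map_comp, ← hxy, ← Submodule.map_comp,
      ← Module.End.mul_eq_comp, rho_inv_mul]
    exact Submodule.map_id _
  have htop := hρ H hH (E χ) hχ (fun h hh w hw => by
    have hh' : (E χ).map (ρ h) = E χ := hh
    rw [← hh']; exact ⟨w, hw, rfl⟩)
  intro a ha
  refine ⟨χ ⟨a, ha⟩, fun v => ?_⟩
  have hv : v ∈ E χ := by rw [htop]; trivial
  exact (memE _ _).1 hv ⟨a, ha⟩

lemma det_ne_zero (ρ : G →* Module.End K V) (g : G) : LinearMap.det (ρ g) ≠ 0 := by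
  intro h
  have := congrArg LinearMap.det (rho_mul_inv ρ g)
  rw [map_mul, h] at this
  simp at this

lemma finite_roots (D δ : K) (hD : D ≠ 0) :
    {μ : K | μ ^ (Module.finrank K V) * D = δ}.Finite := by
  have hd : 0 < Module.finrank K V := Module.finrank_pos
  classical
  refine ((Polynomial.nthRoots (Module.finrank K V) (δ / D)).toFinset.finite_toSet).subset ?_
  intro μ hμ
  simp only [Finset.mem_coe, Multiset.mem_toFinset, Polynomial.mem_nthRoots hd]
  exact eq_div_of_mul_eq hD hμ

lemma scal_of_commutator_scal {ρ : G →* Module.End K V} (hρ : StrIrr ρ) (A : Subgroup G)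
    (hA : A.Normal) (hcomm : ∀ x ∈ A, ∀ y ∈ A, Scal ρ ⁅x, y⁆) : ∀ a ∈ A, Scal ρ a := by
  let Z : Subgroup G := A ⊓ (Subgroup.centralizer (A.map ρ.toHomUnits)).comap ρ.toHomUnits
  have hmem : ∀ x, x ∈ Z ↔ x ∈ A ∧ ∀ a ∈ A, ρ a * ρ x = ρ x * ρ a := by
    intro x
    simp only [Z, Subgroup.mem_inf, Subgroup.mem_comap, Subgroup.mem_centralizer_iff,
      Subgroup.coe_map, Set.forall_mem_image, SetLike.mem_coe]
    simp only [Units.ext_iff, Units.val_mul, MonoidHom.coe_toHomUnits]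
  have hZ : Z.Normal := by
    refine ⟨fun n hn g => ?_⟩
    rw [hmem] at hn ⊢
    refine ⟨hA.conj_mem n hn.1 g, fun a ha => ?_⟩
    have h1 := hn.2 (g⁻¹ * a * g) (by simpa using hA.conj_mem a ha g⁻¹)
    rw [← map_mul, ← map_mul] at h1 ⊢
    have e1 : a * (g * n * g⁻¹) = g * (g⁻¹ * a * g * n) * g⁻¹ := by group
    have e2 : (g * n * g⁻¹) * a = g * (n * (g⁻¹ * a * g)) * g⁻¹ := by group
    rw [e1, e2, map_mul, map_mul, h1, ← map_mul, ← map_mul]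
  have hZs : ∀ z ∈ Z, Scal ρ z := scal_of_comm hρ Z hZ (fun x hx y hy =>
    ((hmem y).1 hy).2 x ((hmem x).1 hx).1)
  -- `Z` has finite index in `A`
  have hfi : (Z.subgroupOf A).FiniteIndex := by
    obtain ⟨t, htsub, htspan⟩ := (Submodule.fg_span_iff_fg_span_finset_subset
      (ρ '' (A : Set G))).1 (IsNoetherian.noetherian (Submodule.span K (ρ '' (A : Set G))))
    let f : A → (t → Module.End K V) := fun x T => ρ x * T * ρ (x : G)⁻¹
    refine finiteIndex_of_map (Z.subgroupOf A) f ?_ ?_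
    · have hfin : (Set.pi Set.univ fun T : t =>
          (fun μ : K => μ • (T : Module.End K V)) ''
            {μ : K | μ ^ (Module.finrank K V) * 1 = 1}).Finite :=
        Set.Finite.pi fun T => (finite_roots (V := V) (1 : K) 1 one_ne_zero).image _
      refine hfin.subset ?_
      rintro _ ⟨x, rfl⟩ T -
      obtain ⟨a, ha, haT⟩ := htsub T.2
      obtain ⟨μ, hμ⟩ := hcomm x x.2 a ha
      have e : ρ x * T * ρ (x : G)⁻¹ = μ • (T : Module.End K V) := by
        rw [← haT, ← map_mul, ← map_mul]
        have e1 : (x : G) * a * (x : G)⁻¹ = ⁅(x : G), a⁆ * a := by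
          simp [commutatorElement_def]
        ext v
        rw [e1, map_mul, Module.End.mul_apply, hμ, LinearMap.smul_apply]
      refine ⟨μ, ?_, e.symm⟩
      have hdet := congrArg LinearMap.det e
      have hT0 : LinearMap.det (T : Module.End K V) ≠ 0 := by
        rw [← haT]; exact det_ne_zero ρ a
      have hx := congrArg LinearMap.det (rho_mul_inv ρ (x : G))
      rw [LinearMap.det_smul, map_mul, map_mul, mul_right_comm, ← map_mul, hx] at hdet
      simp only [map_one, one_mul] at hdet
      have : μ ^ Module.finrank K V = 1 := by
        apply mul_right_cancel₀ hT0
        rw [← hdet, one_mul]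
      simpa using this
    · intro x y hxy
      rw [Subgroup.mem_subgroupOf, hmem]
      refine ⟨(x⁻¹ * y).2, ?_⟩
      have hc : ∀ T ∈ t, T * ρ ((x : G)⁻¹ * y) = ρ ((x : G)⁻¹ * y) * T := by
        intro T hT
        have h1 : ρ x * T * ρ (x : G)⁻¹ = ρ y * T * ρ (y : G)⁻¹ := congrFun hxy ⟨T, hT⟩
        rw [map_mul]
        calc T * (ρ (x : G)⁻¹ * ρ y) = (ρ (x : G)⁻¹ * ρ x) * T * (ρ (x : G)⁻¹ * ρ y) := by
              rw [rho_inv_mul, one_mul]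
          _ = ρ (x : G)⁻¹ * (ρ x * T * ρ (x : G)⁻¹) * ρ y := by simp only [mul_assoc]
          _ = ρ (x : G)⁻¹ * ρ y * T * (ρ (y : G)⁻¹ * ρ y) := by rw [h1]; simp only [mul_assoc]
          _ = ρ (x : G)⁻¹ * ρ y * T := by rw [rho_inv_mul, mul_one]
      intro a ha
      have h2 : ρ a ∈ Submodule.span K (t : Set (Module.End K V)) := by
        rw [← htspan]; exact Submodule.subset_span ⟨a, ha, rfl⟩
      change ρ a * ρ ((x : G)⁻¹ * y) = ρ ((x : G)⁻¹ * y) * ρ a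
      generalize ρ a = R at h2 ⊢
      induction h2 using Submodule.span_induction with
      | mem T hT => exact hc T hT
      | zero => simp
      | add T S _ _ h1 h2 => rw [add_mul, mul_add, h1, h2]
      | smul c T _ h1 => rw [smul_mul_assoc, mul_smul_comm, h1]
  intro a ha
  apply scal_of_finite_orbit hρ
  have hfinq : Finite (A ⧸ Z.subgroupOf A) := inferInstance
  have hfin : (⋃ q : A ⧸ Z.subgroupOf A, (fun μ : K => μ • ρ (q.out : A)) ''
      {μ : K | μ ^ (Module.finrank K V) * LinearMap.det (ρ (q.out : A)) =
        LinearMap.det (ρ a)}).Finite :=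
    Set.finite_iUnion fun q => (finite_roots (V := V) _ _ (det_ne_zero ρ _)).image _
  refine hfin.subset ?_
  rintro _ ⟨g, rfl⟩
  let x : A := ⟨g * a * g⁻¹, hA.conj_mem a ha g⟩
  have hdet : LinearMap.det (ρ x) = LinearMap.det (ρ a) := by
    have hx := congrArg LinearMap.det (rho_mul_inv ρ g)
    change LinearMap.det (ρ (g * a * g⁻¹)) = _
    rw [map_mul, map_mul, map_mul, map_mul, mul_right_comm, ← map_mul, hx]
    simp
  rw [Set.mem_iUnion]
  refine ⟨(x : A ⧸ Z.subgroupOf A), ?_⟩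
  set q : A := (x : A ⧸ Z.subgroupOf A).out with hq
  have hqx : q⁻¹ * x ∈ Z.subgroupOf A := by
    rw [← QuotientGroup.eq]; simp [hq]
  obtain ⟨μ, hμ⟩ := hZs _ (Subgroup.mem_subgroupOf.1 hqx)
  have e : μ • ρ q = ρ x := by
    have e1 : (x : G) = q * ((q⁻¹ * x : A) : G) := by simp
    ext v
    rw [e1, map_mul, Module.End.mul_apply, hμ, map_smul, LinearMap.smul_apply]
  refine ⟨μ, ?_, e⟩
  change _ = _
  rw [← LinearMap.det_smul, e, hdet]

lemma scal_of_solvable {ρ : G →* Module.End K V} (hρ : StrIrr ρ) [Group.IsSolvable G] :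
    ∀ g, Scal ρ g := by
  obtain ⟨n, hn⟩ := Group.IsSolvable.solvable (G := G)
  have key : ∀ j k, k + j = n → ∀ g ∈ derivedSeries G k, Scal ρ g := by
    intro j
    induction j with
    | zero =>
      rintro k rfl g hg
      rw [add_zero] at hn
      rw [hn, Subgroup.mem_bot] at hg
      exact ⟨1, by simp [hg]⟩
    | succ j ih =>
      intro k hk
      refine scal_of_commutator_scal hρ _ (derivedSeries_normal G k) ?_
      intro x hx y hy
      apply ih (k + 1) (by omega)
      rw [derivedSeries_succ]
      exact Subgroup.commutator_mem_commutator hx hy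
  intro g
  exact key n 0 (by simp) g (by simp)

end MalcevAux

namespace MalcevAux
open scoped commutatorElement
universe u v w

lemma exists_eigen {K : Type u} [Field K] [IsAlgClosed K] (n : ℕ) :
    ∀ (V : Type v) [AddCommGroup V] [Module K V] [FiniteDimensional K V] [Nontrivial V]
      (G : Type w) [Group G] [Group.IsSolvable G] (ρ : G →* Module.End K V),
      Module.finrank K V = n →
      ∃ H : Subgroup G, H.FiniteIndex ∧ ∃ v : V, v ≠ 0 ∧ ∀ h ∈ H, ∃ μ : K, ρ h v = μ • v := by
  induction n using Nat.strong_induction_on with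
  | _ n ih =>
    intro V _ _ _ _ G _ _ ρ hn
    by_cases hρ : StrIrr ρ
    · obtain ⟨v, hv⟩ := exists_ne (0 : V)
      refine ⟨⊤, inferInstance, v, hv, fun h _ => ?_⟩
      obtain ⟨μ, hμ⟩ := scal_of_solvable hρ h
      exact ⟨μ, hμ v⟩
    · unfold StrIrr at hρ
      push Not at hρ
      obtain ⟨H, hH, W, hW0, hinv, hWtop⟩ := hρ
      have : Nontrivial W := Submodule.nontrivial_iff_ne_bot.2 hW0
      let ρ' : H →* Module.End K W :=
        { toFun := fun h => (ρ h).restrict (hinv h h.2)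
          map_one' := by ext; simp
          map_mul' := by intro a b; ext; simp }
      obtain ⟨H', hH', w, hw0, hw⟩ := ih (Module.finrank K W)
        (hn ▸ Submodule.finrank_lt hWtop) W H ρ' rfl
      refine ⟨H'.map H.subtype, ?_, w, by simpa using hw0, ?_⟩
      · rw [Subgroup.finiteIndex_iff, Subgroup.index_map_subtype]
        exact mul_ne_zero hH'.index_ne_zero hH.index_ne_zero
      · rintro _ ⟨h, hh, rfl⟩
        obtain ⟨μ, hμ⟩ := hw h hh
        exact ⟨μ, congrArg Subtype.val hμ⟩

lemma exists_flag {K : Type u} [Field K] [IsAlgClosed K] (n : ℕ) :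
    ∀ (V : Type v) [AddCommGroup V] [Module K V] [FiniteDimensional K V]
      (G : Type w) [Group G] [Group.IsSolvable G] (ρ : G →* Module.End K V),
      Module.finrank K V = n →
      ∃ H : Subgroup G, H.FiniteIndex ∧ ∃ (c : ℕ → Submodule K V) (m : ℕ), Monotone c ∧
        c 0 = ⊥ ∧ c m = ⊤ ∧
        ∀ h ∈ H, ∀ i, ∃ μ : K, ∀ v ∈ c (i + 1), ρ h v - μ • v ∈ c i := by
  induction n using Nat.strong_induction_on with
  | _ n ih =>
    intro V _ _ _ G _ _ ρ hn
    rcases subsingleton_or_nontrivial V with hV | hV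
    · refine ⟨⊤, inferInstance, fun _ => ⊥, 0, monotone_const, rfl, Subsingleton.elim _ _, ?_⟩
      intro h _ i
      exact ⟨1, fun v _ => by rw [Submodule.mem_bot]; exact Subsingleton.elim _ _⟩
    · obtain ⟨H, hH, v, hv0, hv⟩ := exists_eigen n V G ρ hn
      let L : Submodule K V := K ∙ v
      have hL : ∀ h ∈ H, ∃ μ : K, ∀ w ∈ L, ρ h w = μ • w := by
        intro h hh
        obtain ⟨μ, hμ⟩ := hv h hh
        refine ⟨μ, fun w hw => ?_⟩
        obtain ⟨a, rfl⟩ := Submodule.mem_span_singleton.1 hw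
        rw [map_smul, hμ, smul_comm]
      have hinv : ∀ h : H, L ≤ L.comap (ρ h) := by
        intro h w hw
        obtain ⟨μ, hμ⟩ := hL h h.2
        rw [Submodule.mem_comap, hμ w hw]
        exact L.smul_mem _ hw
      let ρ' : H →* Module.End K (V ⧸ L) :=
        { toFun := fun h => L.mapQ L (ρ h) (hinv h)
          map_one' := by ext; simp
          map_mul' := by intro a b; ext; simp }
      have hlt : Module.finrank K (V ⧸ L) < n := by
        have h1 := L.finrank_quotient_add_finrank
        have h2 : Module.finrank K L = 1 := finrank_span_singleton hv0
        omega
      obtain ⟨H', hH', c, m, hc, hc0, hcm, hcs⟩ := ih _ hlt (V ⧸ L) H ρ' rfl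
      refine ⟨H'.map H.subtype, ?_,
        fun i => Nat.casesOn i ⊥ (fun j => (c j).comap L.mkQ), m + 1, ?_, rfl, ?_, ?_⟩
      · rw [Subgroup.finiteIndex_iff, Subgroup.index_map_subtype]
        exact mul_ne_zero hH'.index_ne_zero hH.index_ne_zero
      · refine monotone_nat_of_le_succ ?_
        rintro (_ | i)
        · exact bot_le
        · exact Submodule.comap_mono (hc (Nat.le_succ i))
      · change (c m).comap L.mkQ = ⊤
        rw [hcm, Submodule.comap_top]
      · rintro _ ⟨h, hh, rfl⟩ (_ | i)
        · obtain ⟨μ, hμ⟩ := hL h h.2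
          refine ⟨μ, fun w hw => ?_⟩
          have hw' : w ∈ (c 0).comap L.mkQ := hw
          rw [hc0, Submodule.mem_comap, Submodule.mem_bot, ← LinearMap.mem_ker,
            Submodule.ker_mkQ] at hw'
          change _ ∈ (⊥ : Submodule K V)
          rw [Submodule.mem_bot, sub_eq_zero]
          exact hμ w hw'
        · obtain ⟨μ, hμ⟩ := hcs h hh i
          exact ⟨μ, fun w hw => hμ (L.mkQ w) hw⟩

lemma nilpotent_of_flag {K : Type*} [Field K] {V : Type*} [AddCommGroup V] [Module K V]
    {T : Type*} [Group T] (ρ : T →* Module.End K V) (hinj : Function.Injective ρ)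
    (c : ℕ → Submodule K V) (m : ℕ) (hc : Monotone c) (hc0 : c 0 = ⊥) (hcm : c m = ⊤)
    (hcs : ∀ h i, ∃ μ : K, ∀ v ∈ c (i + 1), ρ h v - μ • v ∈ c i) :
    Group.IsNilpotent (commutator T) := by
  have hinv : ∀ h i, ∀ v ∈ c i, ρ h v ∈ c i := by
    rintro h (_ | i) v hv
    · rw [hc0, Submodule.mem_bot] at hv ⊢
      rw [hv, map_zero]
    · obtain ⟨μ, hμ⟩ := hcs h i
      have := (c (i + 1)).add_mem (hc (Nat.le_succ i) (hμ v hv)) ((c (i + 1)).smul_mem μ hv)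
      simpa using this
  let U : ℕ → Subgroup T := fun k =>
    { carrier := {x | ∀ i, ∀ v ∈ c (i + k + 1), ρ x v - v ∈ c i}
      one_mem' := by intro i v _; simp
      mul_mem' := by
        intro x y hx hy i v hv
        have := (c i).add_mem (hinv x i _ (hy i v hv)) (hx i v hv)
        simpa using this
      inv_mem' := by
        intro x hx i v hv
        have := (c i).neg_mem (hinv x⁻¹ i _ (hx i v hv))
        simpa [rho_inv_apply] using this }
  have hcomm : ∀ (x y : T) (v : V), ∃ w, (∀ i, v ∈ c i → w ∈ c i) ∧
      ρ ⁅x, y⁆ v - v = ρ x (ρ y w) - ρ y (ρ x w) := by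
    intro x y v
    refine ⟨ρ x⁻¹ (ρ y⁻¹ v), fun i hv => hinv _ _ _ (hinv _ _ _ hv), ?_⟩
    rw [rho_apply_inv, rho_apply_inv, commutatorElement_def]
    simp
  have hU0 : commutator T ≤ U 0 := by
    rw [commutator_def, Subgroup.commutator_le]
    intro x _ y _ i v hv
    obtain ⟨w, hw, e⟩ := hcomm x y v
    rw [e]
    have hw := hw _ hv
    obtain ⟨μ, hμ⟩ := hcs x i
    obtain ⟨ν, hν⟩ := hcs y i
    have h1 := (c i).add_mem (hinv x i _ (hν w hw)) ((c i).smul_mem ν (hμ w hw))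
    have h2 := (c i).add_mem (hinv y i _ (hμ w hw)) ((c i).smul_mem μ (hν w hw))
    have h3 := (c i).sub_mem h1 h2
    convert h3 using 1
    simp only [map_sub, map_smul, smul_sub, smul_comm μ ν]
    abel
  rw [Subgroup.nilpotent_iff_finite_descending_central_series]
  refine ⟨m, fun k => (U k).subgroupOf (commutator T), ⟨?_, ?_⟩, ?_⟩
  · exact Subgroup.subgroupOf_eq_top.2 hU0
  · intro x k hx g
    rw [Subgroup.mem_subgroupOf] at hx ⊢
    have hg := hU0 g.2
    intro i v hv
    obtain ⟨w, hw, e⟩ := hcomm x g v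
    have hw := hw _ hv
    change ρ ⁅(x : T), (g : T)⁆ v - v ∈ c i
    rw [e]
    have h1 := hx i _ (hg (i + k + 1) w hw)
    have h2 := hg i _ (hx (i + 1) w (by convert hw using 2; ring))
    have h3 := (c i).sub_mem h1 h2
    convert h3 using 1
    simp only [map_sub]
    abel
  · rw [eq_bot_iff]
    intro x hx
    rw [Subgroup.mem_subgroupOf] at hx
    rw [Subgroup.mem_bot]
    apply Subtype.ext
    apply hinj
    ext v
    have h1 := hx 0 v (hc (by omega : m ≤ 0 + m + 1) (by rw [hcm]; trivial))
    rw [hc0, Submodule.mem_bot, sub_eq_zero] at h1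
    simpa using h1

end MalcevAux

/-- A solvable subgroup `S` of `GL(d,F)` has a finite index subgroup `T` which is
nilpotent-by-abelian: there is a normal subgroup `N` of `T` with `N` nilpotent and
`T/N` abelian (equivalently, every commutator of elements of `T` lies in `N`). -/
theorem stmt_9 {d : ℕ} (hd : 0 < d) {F : Type} [Field F] (S : Subgroup (GL (Fin d) F))
    (hsolv : IsSolvable ↥S) :
    ∃ T : Subgroup ↥S, T.FiniteIndex ∧
      ∃ N : Subgroup ↥T, N.Normal ∧ Group.IsNilpotent ↥N ∧
        ∀ x y : ↥T, x * y * x⁻¹ * y⁻¹ ∈ N := by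
  have hsolv' : Group.IsSolvable S := hsolv
  let K := AlgebraicClosure F
  let ι : Matrix (Fin d) (Fin d) F →* Module.End K (Fin d → K) :=
    (Matrix.toLinAlgEquiv' (R := K) (n := Fin d)).toRingEquiv.toRingHom.toMonoidHom.comp
      ((algebraMap F K).mapMatrix (m := Fin d)).toMonoidHom
  have hι : Function.Injective ι := by
    intro A B h
    have h1 := (Matrix.toLinAlgEquiv' (R := K) (n := Fin d)).injective h
    exact Matrix.map_injective (algebraMap F K).injective h1
  let ρ : S →* Module.End K (Fin d → K) := (ι.comp (Units.coeHom _)).comp S.subtype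
  have hρ : Function.Injective ρ := by
    intro x y h
    exact Subtype.ext (Units.ext (hι h))
  obtain ⟨T, hT, c, m, hc, hc0, hcm, hcs⟩ :=
    MalcevAux.exists_flag (K := K) _ (Fin d → K) S ρ rfl
  refine ⟨T, hT, commutator T, inferInstance, ?_, ?_⟩
  · exact MalcevAux.nilpotent_of_flag (ρ.comp T.subtype)
      (hρ.comp Subtype.val_injective) c m hc hc0 hcm (fun h i => hcs h h.2 i)
  · intro x y
    exact Subgroup.commutator_mem_commutator (Subgroup.mem_top x) (Subgroup.mem_top y)
end

section
/- Let S be a solvable group which is NIU-linear, i.e. S admits a faithful representation into GL(d,F), for some positive integer d and field F, whose image has the property that every unipotent element has finite order. Then S is virtually torsion-by-abelian: S has a finite index subgroup T with a normal subgroup N such that every element of N has finite order and T/N is abelian. If moreover the field F has characteristic zero, then S is virtually abelian. -/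
open Matrix

namespace NIU

/-- A subgroup is of finite index if a function with finite range separates its cosets. -/
lemma finiteIndex_of_finite_range {H : Type*} [Group H] (L : Subgroup H) {α : Type*} (f : H → α)
    (hf : (Set.range f).Finite) (h : ∀ x y, f x = f y → x⁻¹ * y ∈ L) : L.FiniteIndex := by
  have : Finite (Set.range f) := hf
  have : Finite (H ⧸ L) := by
    refine Finite.of_injective
      (fun q : H ⧸ L => (⟨f q.out, Set.mem_range_self _⟩ : Set.range f)) ?_
    intro p q hpq
    have h1 : f p.out = f q.out := congrArg Subtype.val hpq
    have h2 := h _ _ h1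
    rw [← QuotientGroup.out_eq' p, ← QuotientGroup.out_eq' q]
    exact QuotientGroup.eq.mpr h2
  exact Subgroup.finiteIndex_of_finite_quotient

variable {K : Type*} [Field K] {G : Type*} [Group G] {V : Type*} [AddCommGroup V] [Module K V]

/-- Every finite index subgroup acts irreducibly. -/
def StrongIrr (ρ : Representation K G V) : Prop :=
  ∀ H : Subgroup G, H.FiniteIndex → ∀ W : Submodule K V,
    (∀ h ∈ H, ∀ w ∈ W, ρ h w ∈ W) → W = ⊥ ∨ W = ⊤

/-- Acting as a scalar. -/
def IsScalar (f : Module.End K V) : Prop := ∃ c : K, f = c • 1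

lemma scalar_of_commute [IsAlgClosed K] [FiniteDimensional K V] [Nontrivial V]
    {ρ : Representation K G V} (hρ : StrongIrr ρ) (f : Module.End K V) (H : Subgroup G)
    (hH : H.FiniteIndex) (hc : ∀ h ∈ H, ρ h * f = f * ρ h) : IsScalar f := by
  obtain ⟨c, hcv⟩ := Module.End.exists_eigenvalue f
  refine ⟨c, ?_⟩
  have hinv : ∀ h ∈ H, ∀ w ∈ f.eigenspace c, ρ h w ∈ f.eigenspace c := by
    intro h hh w hw
    rw [Module.End.mem_eigenspace_iff] at hw ⊢
    have := LinearMap.congr_fun (hc h hh) w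
    simp only [Module.End.mul_apply] at this
    rw [← this, hw, map_smul]
  rcases hρ H hH (f.eigenspace c) hinv with h | h
  · exact absurd h hcv
  · ext v
    have : v ∈ f.eigenspace c := h ▸ Submodule.mem_top
    simpa using Module.End.mem_eigenspace_iff.mp this

lemma exists_common_eigenvector [IsAlgClosed K] [FiniteDimensional K V] [Nontrivial V]
    (s : Set (Module.End K V)) (hs : ∀ a ∈ s, ∀ b ∈ s, a * b = b * a) :
    ∃ v : V, v ≠ 0 ∧ ∀ a ∈ s, ∃ c : K, a v = c • v := by
  let S : Set (Submodule K V) := {W | W ≠ ⊥ ∧ ∀ a ∈ s, ∀ w ∈ W, a w ∈ W}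
  have hne : S.Nonempty := ⟨⊤, top_ne_bot, by simp⟩
  obtain ⟨W, ⟨hW0, hWs⟩, hmin⟩ := WellFounded.has_min (wellFounded_lt (α := Submodule K V)) S hne
  obtain ⟨v, hvW, hv0⟩ := Submodule.exists_mem_ne_zero_of_ne_bot hW0
  refine ⟨v, hv0, fun a ha => ?_⟩
  have : Nontrivial W := ⟨⟨⟨v, hvW⟩, 0, fun h => hv0 (congrArg Subtype.val h)⟩⟩
  obtain ⟨c, hc⟩ := Module.End.exists_eigenvalue (LinearMap.restrict a (hWs a ha))
  obtain ⟨u, hu⟩ := hc.exists_hasEigenvector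
  refine ⟨c, ?_⟩
  have hmem : W ⊓ a.eigenspace c ∈ S := by
    refine ⟨?_, ?_⟩
    · intro h
      have h1 : (u : V) ∈ W ⊓ a.eigenspace c := by
        refine ⟨u.2, ?_⟩
        rw [SetLike.mem_coe, Module.End.mem_eigenspace_iff]
        simpa using congrArg Subtype.val hu.apply_eq_smul
      rw [h] at h1
      exact hu.2 (Subtype.ext (by simpa using h1))
    · rintro b hb w ⟨hw, hw'⟩
      refine ⟨hWs b hb w hw, ?_⟩
      rw [SetLike.mem_coe, Module.End.mem_eigenspace_iff] at hw' ⊢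
      have := LinearMap.congr_fun (hs a ha b hb) w
      simp only [Module.End.mul_apply] at this
      rw [this, hw', map_smul]
  have h2 : W ⊓ a.eigenspace c = W := by
    by_contra hh
    exact hmin _ hmem (lt_of_le_of_ne inf_le_left hh)
  have h3 : v ∈ W ⊓ a.eigenspace c := by rw [h2]; exact hvW
  exact Module.End.mem_eigenspace_iff.mp h3.2

lemma scalar_of_abelian [IsAlgClosed K] [FiniteDimensional K V] [Nontrivial V]
    {ρ : Representation K G V} (hρ : StrongIrr ρ) (A : Subgroup G) (hA : A.Normal)
    (hc : ∀ a ∈ A, ∀ b ∈ A, ρ a * ρ b = ρ b * ρ a) : ∀ a ∈ A, IsScalar (ρ a) := by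
  obtain ⟨v, hv0, hv⟩ := exists_common_eigenvector (ρ '' (A : Set G)) (by
    rintro _ ⟨a, ha, rfl⟩ _ ⟨b, hb, rfl⟩
    exact hc a ha b hb)
  have hv' : ∀ a : G, ∃ c : K, a ∈ A → ρ a v = c • v := by
    intro a
    by_cases ha : a ∈ A
    · obtain ⟨c, hc⟩ := hv (ρ a) ⟨a, ha, rfl⟩
      exact ⟨c, fun _ => hc⟩
    · exact ⟨0, fun h => absurd h ha⟩
  choose χ hχ using hv'
  have hfin : {φ : A → K | (⨅ a : A, Module.End.maxGenEigenspace (ρ a) (φ a)) ≠ ⊥}.Finite := by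
    apply WellFoundedGT.finite_ne_bot_of_iSupIndep
    apply Module.End.independent_iInf_maxGenEigenspace_of_forall_mapsTo (fun a : A => ρ a)
    intro i j φ
    exact Module.End.mapsTo_maxGenEigenspace_of_comm (hc j j.2 i i.2) φ
  have hconj : ∀ g a : G, a ∈ A → g⁻¹ * a * g ∈ A := fun g a ha => by
    simpa using hA.conj_mem a ha g⁻¹
  have hconj' : ∀ g a : G, a ∈ A → g * a * g⁻¹ ∈ A := fun g a ha => hA.conj_mem a ha g
  have hmove : ∀ (w : V) (c : K) (g a : G), ρ (g⁻¹ * a * g) w = c • w →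
      ρ a (ρ g w) = c • ρ g w := by
    intro w c g a h
    have h1 : ρ g (ρ (g⁻¹ * a * g) w) = ρ g (c • w) := by rw [h]
    rw [map_smul, ← Module.End.mul_apply, ← map_mul] at h1
    rw [← h1, ← Module.End.mul_apply, ← map_mul]
    congr 2
    group
  let H : Subgroup G :=
    { carrier := {g | ∀ a ∈ A, χ (g⁻¹ * a * g) = χ a}
      one_mem' := by intro a _; simp
      mul_mem' := by
        intro x y hx hy a ha
        have h1 := hy _ (hconj x a ha)
        rw [← hx a ha, ← h1]
        congr 1
        group
      inv_mem' := by
        intro x hx a ha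
        have h1 := hx _ (hconj' x a ha)
        rw [inv_inv, ← h1]
        congr 1
        group }
  have hH : H.FiniteIndex := by
    refine finiteIndex_of_finite_range H (fun g => fun a : A => χ (g⁻¹ * a * g))
      (hfin.subset ?_) ?_
    · rintro _ ⟨g, rfl⟩
      rw [Set.mem_setOf_eq, Submodule.ne_bot_iff]
      refine ⟨ρ g v, ?_, ?_⟩
      · rw [Submodule.mem_iInf]
        intro a
        have h1 := hmove v _ g a (hχ _ (hconj g a a.2))
        exact Module.End.mem_maxGenEigenspace _ _ _ |>.mpr ⟨1, by simp [h1]⟩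
      · intro h
        apply hv0
        have : ρ g⁻¹ (ρ g v) = 0 := by rw [h, map_zero]
        simpa using this
    · intro x y hxy a ha
      have h1 := congrFun hxy ⟨x * a * x⁻¹, hconj' x a ha⟩
      simp only at h1
      have e1 : x⁻¹ * (x * a * x⁻¹) * x = a := by group
      have e2 : y⁻¹ * (x * a * x⁻¹) * y = (x⁻¹ * y)⁻¹ * a * (x⁻¹ * y) := by group
      rw [e1, e2] at h1
      exact h1.symm
  let W : Submodule K V := ⨅ a : A, Module.End.eigenspace (ρ a) (χ a)
  have hW : ∀ w, w ∈ W ↔ ∀ a ∈ A, ρ a w = χ a • w := by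
    intro w
    simp only [W, Submodule.mem_iInf, Module.End.mem_eigenspace_iff, Subtype.forall]
  have hinv : ∀ h ∈ H, ∀ w ∈ W, ρ h w ∈ W := by
    intro h hh w hw
    rw [hW] at hw ⊢
    intro a ha
    have h1 := hmove w _ h a (hw _ (hconj h a ha))
    rw [h1, hh a ha]
  have hWtop : W = ⊤ := by
    refine (hρ H hH W hinv).resolve_left fun h => hv0 ?_
    have : v ∈ W := (hW v).mpr fun a ha => hχ a ha
    rw [h] at this
    simpa using this
  intro a ha
  refine ⟨χ a, ?_⟩
  ext w
  have : w ∈ W := hWtop ▸ Submodule.mem_top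
  simpa using (hW w).mp this a ha

lemma finite_pow_eq {n : ℕ} (hn : 0 < n) (b c : K) (hb : b ≠ 0) : {x : K | x ^ n * b = c}.Finite := by
  classical
  refine (Polynomial.nthRoots n (c / b)).toFinset.finite_toSet.subset ?_
  intro x hx
  simp only [Set.mem_setOf_eq] at hx
  simp [Polynomial.mem_nthRoots hn, ← hx, hb]

lemma det_ne_zero (ρ : Representation K G V) (g : G) : LinearMap.det (ρ g) ≠ 0 := by
  have : LinearMap.det (ρ g) * LinearMap.det (ρ g⁻¹) = 1 := by
    rw [← map_mul, ← map_mul]; simp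
  exact left_ne_zero_of_mul_eq_one this

lemma det_conj (ρ : Representation K G V) (g x : G) :
    LinearMap.det (ρ (x * g * x⁻¹)) = LinearMap.det (ρ g) := by
  have : LinearMap.det (ρ x) * LinearMap.det (ρ x⁻¹) = 1 := by
    rw [← map_mul, ← map_mul]; simp
  rw [map_mul, map_mul, map_mul, map_mul, mul_right_comm, this, one_mul]

lemma comm_of_conj_eq (ρ : Representation K G V) (g x y : G)
    (h : ρ (x * g * x⁻¹) = ρ (y * g * y⁻¹)) :
    ρ (x⁻¹ * y) * ρ g = ρ g * ρ (x⁻¹ * y) := by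
  have h1 : ρ x⁻¹ * ρ (x * g * x⁻¹) * ρ y = ρ x⁻¹ * ρ (y * g * y⁻¹) * ρ y := by rw [h]
  simp only [← map_mul] at h1 ⊢
  have e1 : x⁻¹ * (x * g * x⁻¹) * y = g * (x⁻¹ * y) := by group
  have e2 : x⁻¹ * (y * g * y⁻¹) * y = x⁻¹ * y * g := by group
  rw [e1, e2] at h1
  exact h1.symm

/-- Conjugates of `g` that are scalar multiples of finitely many elements are finite in number. -/
lemma finite_smul_det [FiniteDimensional K V] [Nontrivial V]
    (ρ : Representation K G V) (r : G) (δ : K) :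
    {f : Module.End K V | (∃ c : K, f = c • ρ r) ∧ LinearMap.det f = δ}.Finite := by
  refine ((finite_pow_eq (K := K) (n := Module.finrank K V) Module.finrank_pos
    (LinearMap.det (ρ r)) δ (det_ne_zero ρ r)).image (fun c => c • ρ r)).subset ?_
  rintro f ⟨⟨c, rfl⟩, h⟩
  refine ⟨c, ?_, rfl⟩
  rw [LinearMap.det_smul] at h
  exact h

lemma scalar_step [IsAlgClosed K] [FiniteDimensional K V] [Nontrivial V]
    {ρ : Representation K G V} (hρ : StrongIrr ρ) (N : Subgroup G) (hN : N.Normal)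
    (hc : ∀ a ∈ N, ∀ b ∈ N, IsScalar (ρ (a * b * a⁻¹ * b⁻¹))) : ∀ a ∈ N, IsScalar (ρ a) := by
  -- a finite subset of `N` whose image spans
  obtain ⟨t, htN, -, hts, -⟩ := Submodule.exists_finset_span_eq_linearIndepOn K (ρ '' (N : Set G))
  let Z : Subgroup G :=
    { carrier := {x | x ∈ N ∧ ∀ y ∈ N, ρ x * ρ y = ρ y * ρ x}
      one_mem' := ⟨N.one_mem, by simp⟩
      mul_mem' := by
        rintro x y ⟨hx, hx'⟩ ⟨hy, hy'⟩
        refine ⟨N.mul_mem hx hy, fun z hz => ?_⟩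
        rw [map_mul, mul_assoc, hy' z hz, ← mul_assoc, hx' z hz, mul_assoc]
      inv_mem' := by
        rintro x ⟨hx, hx'⟩
        refine ⟨N.inv_mem hx, fun z hz => ?_⟩
        have h1 : ρ x⁻¹ * (ρ x * ρ z) * ρ x⁻¹ = ρ x⁻¹ * (ρ z * ρ x) * ρ x⁻¹ := by rw [hx' z hz]
        simp only [← map_mul] at h1 ⊢
        have e1 : x⁻¹ * (x * z) * x⁻¹ = z * x⁻¹ := by group
        have e2 : x⁻¹ * (z * x) * x⁻¹ = x⁻¹ * z := by group
        rw [e1, e2] at h1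
        exact h1.symm }
  have hZN : Z.Normal := by
    refine ⟨?_⟩
    rintro x ⟨hx, hx'⟩ g
    refine ⟨hN.conj_mem x hx g, fun y hy => ?_⟩
    have hy1 : g⁻¹ * y * g ∈ N := by simpa using hN.conj_mem y hy g⁻¹
    have h1 : ρ g * (ρ x * ρ (g⁻¹ * y * g)) * ρ g⁻¹ = ρ g * (ρ (g⁻¹ * y * g) * ρ x) * ρ g⁻¹ := by
      rw [hx' _ hy1]
    simp only [← map_mul] at h1 ⊢
    have e1 : g * (x * (g⁻¹ * y * g)) * g⁻¹ = g * x * g⁻¹ * y := by group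
    have e2 : g * (g⁻¹ * y * g * x) * g⁻¹ = y * (g * x * g⁻¹) := by group
    rwa [e1, e2] at h1
  have hZs : ∀ a ∈ Z, IsScalar (ρ a) :=
    scalar_of_abelian hρ Z hZN fun a ha b hb => ha.2 b hb.1
  have hZfin : (Z.subgroupOf N).FiniteIndex := by
    refine finiteIndex_of_finite_range _
      (fun x : N => fun f : t => ρ x * (f : Module.End K V) * ρ (x : G)⁻¹) ?_ ?_
    · refine (Set.Finite.pi' (ι := t) (t := fun f : t =>
        {f' : Module.End K V | (∃ c : K, f' = c • f.1) ∧ LinearMap.det f' = LinearMap.det f.1})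
        ?_).subset ?_
      · rintro ⟨f, hf⟩
        obtain ⟨r, hr, rfl⟩ := htN hf
        exact finite_smul_det ρ r _
      · rintro _ ⟨x, rfl⟩ ⟨f, hf⟩
        obtain ⟨r, hr, rfl⟩ := htN hf
        simp only [Set.mem_setOf_eq, ← map_mul]
        refine ⟨?_, det_conj ρ r x⟩
        obtain ⟨c, hc1⟩ := hc x x.2 r hr
        refine ⟨c, ?_⟩
        have e : (x : G) * r * (x : G)⁻¹ = (x * r * (x : G)⁻¹ * r⁻¹) * r := by group
        rw [e, map_mul, hc1]
        simp
    · intro x y hxy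
      rw [Subgroup.mem_subgroupOf]
      refine ⟨(x⁻¹ * y).2, ?_⟩
      have hcomm : ∀ f ∈ t, ρ ((x : G)⁻¹ * y) * f = f * ρ ((x : G)⁻¹ * y) := by
        intro f hf
        obtain ⟨r, hr, hrf⟩ := htN hf
        have h1 := congrFun hxy ⟨f, hf⟩
        simp only [← hrf, ← map_mul] at h1
        rw [← hrf]
        exact comm_of_conj_eq ρ r x y h1
      have hspan : ∀ f ∈ Submodule.span K (t : Set (Module.End K V)),
          ρ ((x : G)⁻¹ * y) * f = f * ρ ((x : G)⁻¹ * y) := by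
        intro f hf
        induction hf using Submodule.span_induction with
        | mem f hf => exact hcomm f hf
        | zero => simp
        | add a b _ _ ha hb => rw [mul_add, add_mul, ha, hb]
        | smul c a _ ha => rw [mul_smul_comm, smul_mul_assoc, ha]
      intro z hz
      refine hspan (ρ z) ?_
      rw [hts]
      exact Submodule.subset_span ⟨z, hz, rfl⟩
  intro n hn
  let H : Subgroup G :=
    { carrier := {x | ρ x * ρ n = ρ n * ρ x}
      one_mem' := by simp
      mul_mem' := by
        intro x y hx hy
        simp only [Set.mem_setOf_eq] at *
        rw [map_mul, mul_assoc, hy, ← mul_assoc, hx, mul_assoc]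
      inv_mem' := by
        intro x hx
        simp only [Set.mem_setOf_eq] at *
        have h1 : ρ x⁻¹ * (ρ x * ρ n) * ρ x⁻¹ = ρ x⁻¹ * (ρ n * ρ x) * ρ x⁻¹ := by rw [hx]
        simp only [← map_mul] at h1 ⊢
        have e1 : x⁻¹ * (x * n) * x⁻¹ = n * x⁻¹ := by group
        have e2 : x⁻¹ * (n * x) * x⁻¹ = x⁻¹ * n := by group
        rw [e1, e2] at h1
        exact h1.symm }
  refine scalar_of_commute hρ (ρ n) H ?_ fun h hh => hh
  have : Finite (N ⧸ Z.subgroupOf N) := inferInstance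
  refine finiteIndex_of_finite_range H (fun g => ρ (g * n * g⁻¹)) ?_
    (fun x y hxy => comm_of_conj_eq ρ n x y hxy)
  refine (Set.finite_iUnion fun q : N ⧸ Z.subgroupOf N =>
    finite_smul_det ρ (q.out : G) (LinearMap.det (ρ n))).subset ?_
  rintro _ ⟨g, rfl⟩
  rw [Set.mem_iUnion]
  let x : N := ⟨g * n * g⁻¹, hN.conj_mem n hn g⟩
  refine ⟨QuotientGroup.mk x, ?_, det_conj ρ n g⟩
  have h1 : (QuotientGroup.mk x : N ⧸ Z.subgroupOf N).out⁻¹ * x ∈ Z.subgroupOf N := by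
    rw [← QuotientGroup.eq, QuotientGroup.out_eq']
  rw [Subgroup.mem_subgroupOf] at h1
  obtain ⟨c, hc1⟩ := hZs _ h1
  refine ⟨c, ?_⟩
  have e : g * n * g⁻¹ = ((QuotientGroup.mk x : N ⧸ Z.subgroupOf N).out : G) *
      (((QuotientGroup.mk x : N ⧸ Z.subgroupOf N).out⁻¹ * x : N) : G) := by
    simp [x]
  change ρ (g * n * g⁻¹) = _
  rw [e, map_mul, hc1]
  simp

lemma scalar_of_solvable [IsAlgClosed K] [FiniteDimensional K V] [Nontrivial V]
    {ρ : Representation K G V} (hρ : StrongIrr ρ) (hG : Group.IsSolvable G) (g : G) :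
    IsScalar (ρ g) := by
  obtain ⟨n, hn⟩ := hG.solvable
  have key : ∀ k ≤ n, ∀ a ∈ derivedSeries G (n - k), IsScalar (ρ a) := by
    intro k
    induction k with
    | zero =>
      intro _ a ha
      rw [Nat.sub_zero, hn, Subgroup.mem_bot] at ha
      exact ⟨1, by simp [ha]⟩
    | succ k ih =>
      intro hk
      have e : n - k = (n - (k + 1)) + 1 := by omega
      refine scalar_step hρ _ (derivedSeries_normal G _) fun a ha b hb => ?_
      refine ih (by omega) _ ?_
      rw [e, derivedSeries_succ]
      exact Subgroup.commutator_mem_commutator ha hb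
  exact key n le_rfl g (by simp)

/-- Malcev: a solvable linear group has a finite index subgroup whose commutator subgroup acts
unipotently. -/
theorem malcev {K : Type*} [Field K] [IsAlgClosed K] (n : ℕ) :
    ∀ {G : Type*} [Group G] (_ : Group.IsSolvable G) {V : Type*} [AddCommGroup V] [Module K V]
      [FiniteDimensional K V] (ρ : Representation K G V), Module.finrank K V = n →
      ∃ T : Subgroup G, T.FiniteIndex ∧ ∀ x ∈ ⁅T, T⁆, IsNilpotent (ρ x - 1) := by
  induction n using Nat.strong_induction_on with
  | _ n ih =>
  intro G _ hG V _ _ _ ρ hn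
  rcases subsingleton_or_nontrivial V with hV | hV
  · exact ⟨⊤, inferInstance, fun x _ => ⟨1, Subsingleton.elim _ _⟩⟩
  by_cases hρ : StrongIrr ρ
  · refine ⟨⊤, inferInstance, fun x hx => ?_⟩
    have hle : ⁅(⊤ : Subgroup G), ⊤⁆ ≤ MonoidHom.ker ρ := by
      rw [Subgroup.commutator_le]
      intro a _ b _
      obtain ⟨c, hc⟩ := scalar_of_solvable hρ hG a
      have h1 : ρ a * ρ b = ρ b * ρ a := by rw [hc]; simp
      rw [MonoidHom.mem_ker, commutatorElement_def]
      have e : a * b * a⁻¹ * b⁻¹ = (a * b) * (b * a)⁻¹ := by group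
      rw [e, map_mul, map_mul, h1, ← map_mul, ← map_mul]
      simp
    have := hle hx
    rw [MonoidHom.mem_ker] at this
    exact ⟨1, by rw [this]; simp⟩
  · simp only [StrongIrr, not_forall, not_or] at hρ
    obtain ⟨H, hH, W, hW, hbot, htop⟩ := hρ
    have hcomap : ∀ g : H, W ≤ W.comap ((ρ.comp H.subtype) g) := fun g w hw => hW g g.2 w hw
    let σ : Representation K H V := ρ.comp H.subtype
    obtain ⟨T1, hT1, h1⟩ := ih _ (hn ▸ Submodule.finrank_lt htop)
      (inferInstance : Group.IsSolvable H) (σ.subrepresentation W hcomap) rfl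
    have hlt : Module.finrank K (V ⧸ W) < n := by
      have := W.finrank_quotient_add_finrank
      have h2 : 0 < Module.finrank K W := by
        rw [Module.finrank_pos_iff, Submodule.nontrivial_iff_ne_bot]; exact hbot
      omega
    obtain ⟨T2, hT2, h2⟩ := ih _ hlt
      (inferInstance : Group.IsSolvable H) (σ.quotient W hcomap) rfl
    refine ⟨(T1 ⊓ T2).map H.subtype, ⟨?_⟩, ?_⟩
    · rw [Subgroup.index_map_subtype]
      exact mul_ne_zero Subgroup.FiniteIndex.index_ne_zero hH.index_ne_zero
    · intro x hx
      rw [← Subgroup.map_commutator] at hx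
      obtain ⟨y, hy, rfl⟩ := hx
      obtain ⟨a, ha⟩ := h1 y (Subgroup.commutator_mono inf_le_left inf_le_left hy)
      obtain ⟨b, hb⟩ := h2 y (Subgroup.commutator_mono inf_le_right inf_le_right hy)
      have hA : ∀ k : ℕ, ∀ w : W,
          ((((σ.subrepresentation W hcomap) y - 1) ^ k) w : V) = ((σ y - 1) ^ k) (w : V) := by
        intro k
        induction k with
        | zero => simp
        | succ k ihk =>
          intro w
          rw [pow_succ, pow_succ, Module.End.mul_apply, Module.End.mul_apply, ihk]
          rfl
      have hB : ∀ k : ℕ, ∀ v : V,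
          (((σ.quotient W hcomap) y - 1) ^ k) (W.mkQ v) = W.mkQ (((σ y - 1) ^ k) v) := by
        intro k
        induction k with
        | zero => simp
        | succ k ihk =>
          intro v
          rw [pow_succ, pow_succ, Module.End.mul_apply, Module.End.mul_apply, ← ihk]
          rfl
      refine ⟨a + b, ?_⟩
      change (σ y - 1) ^ (a + b) = 0
      ext v
      have hm : ((σ y - 1) ^ b) v ∈ W := by
        have := hB b v
        rw [hb] at this
        simpa using this.symm
      have := hA a ⟨_, hm⟩
      rw [ha] at this
      rw [pow_add, Module.End.mul_apply, ← this]
      simp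

/-- A unipotent element of finite order is trivial in characteristic zero. -/
lemma eq_one_of_unipotent {A : Type*} [Ring A] [Algebra ℚ A] (M : A) (h : IsNilpotent (M - 1))
    (n : ℕ) (hn : 0 < n) (hM : M ^ n = 1) : M = 1 := by
  have h1 : (∑ i ∈ Finset.range n, M ^ i) * (M - 1) = 0 := by
    rw [geom_sum_mul, hM, sub_self]
  let Q : A := ∑ i ∈ Finset.range n, ∑ j ∈ Finset.range i, M ^ j
  have hcomm : Commute Q (M - 1) := by
    refine Commute.sum_left _ _ _ fun i _ => Commute.sum_left _ _ _ fun j _ => ?_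
    exact ((Commute.refl M).pow_left j).sub_right (Commute.one_right _)
  have hQ : (∑ i ∈ Finset.range n, M ^ i) = Q * (M - 1) + (n : A) := by
    simp only [Q, Finset.sum_mul]
    simp [← Finset.sum_mul, geom_sum_mul]
  have hnil : IsNilpotent (Q * (M - 1)) := hcomm.isNilpotent_mul_left h
  have hunit : IsUnit (n : A) := by
    have : IsUnit (algebraMap ℚ A (n : ℚ)) :=
      (IsUnit.mk0 (n : ℚ) (by exact_mod_cast hn.ne')).map _
    simpa using this
  have hu : IsUnit (∑ i ∈ Finset.range n, M ^ i) := by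
    rw [hQ]
    exact hnil.isUnit_add_right_of_commute hunit (Nat.commute_cast _ _)
  exact sub_eq_zero.mp (hu.mul_right_eq_zero.mp h1)

end NIU

/-- A solvable NIU-linear group `S` is virtually torsion-by-abelian: it has a finite
index subgroup `T` with a normal subgroup `N` such that every element of `N` has finite
order and `T/N` is abelian. If moreover the field has characteristic zero then `S` is
virtually abelian. -/
theorem stmt_10 {S : Type} [Group S] (hsolv : IsSolvable S)
    {d : ℕ} (hd : 0 < d) {F : Type} [Field F] (ρ : S →* GL (Fin d) F)
    (hinj : Function.Injective ρ)
    (hNIU : ∀ g : S, IsUnipotent (ρ g) → IsOfFinOrder (ρ g)) :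
    (∃ T : Subgroup S, T.FiniteIndex ∧
      ∃ N : Subgroup ↥T, N.Normal ∧ (∀ x : ↥T, x ∈ N → IsOfFinOrder x) ∧
        ∀ x y : ↥T, x * y * x⁻¹ * y⁻¹ ∈ N) ∧
    (CharZero F → ∃ T : Subgroup S, T.FiniteIndex ∧ ∀ x y : ↥T, x * y = y * x) := by
  classical
  let K := AlgebraicClosure F
  let σ : Representation K S (Fin d → K) :=
    ((Matrix.toLinAlgEquiv' : Matrix (Fin d) (Fin d) K ≃ₐ[K] _).toAlgHom.toMonoidHom').comp
      (((algebraMap F K).mapMatrix (m := Fin d)).toMonoidHom.comp ((Units.coeHom _).comp ρ))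
  obtain ⟨T, hT, hnil⟩ := NIU.malcev d hsolv σ (by simp)
  have huni : ∀ x ∈ ⁅T, T⁆, IsUnipotent (ρ x) := by
    intro x hx
    have h1 := hnil x hx
    have h2 : (σ x - 1) ^ d = 0 := by
      have := (LinearMap.isNilpotent_iff_charpoly _).mp h1
      have h3 := LinearMap.aeval_self_charpoly (σ x - 1)
      rw [this] at h3
      simpa using h3
    have e : σ x - 1 = Matrix.toLinAlgEquiv'
        ((algebraMap F K).mapMatrix ((ρ x : Matrix (Fin d) (Fin d) F) - 1)) := by
      rw [map_sub, map_sub, map_one, map_one]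
      rfl
    rw [e, ← map_pow, ← map_pow] at h2
    have h3 := (map_eq_zero_iff _ (AlgEquiv.injective _)).mp h2
    refine (map_eq_zero_iff ((algebraMap F K).mapMatrix (m := Fin d)) ?_).mp h3
    exact Matrix.map_injective (algebraMap F K).injective
  refine ⟨⟨T, hT, ⁅T, T⁆.subgroupOf T, ?_, ?_, ?_⟩, ?_⟩
  · refine ⟨fun n hn g => ?_⟩
    rw [Subgroup.mem_subgroupOf] at hn ⊢
    have e : ((g * n * g⁻¹ : T) : S) = (g * n * (g : S)⁻¹ * (n : S)⁻¹) * n := by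
      simp
    rw [e]
    exact mul_mem (Subgroup.commutator_mem_commutator g.2 n.2) hn
  · intro x hx
    have h1 := hNIU _ (huni x hx)
    rw [hinj.isOfFinOrder_iff] at h1
    exact (Function.Injective.isOfFinOrder_iff (f := T.subtype) T.subtype_injective).mp h1
  · intro x y
    exact Subgroup.commutator_mem_commutator x.2 y.2
  · intro _
    refine ⟨T, hT, fun x y => ?_⟩
    have hx : (x : S) * y * (x : S)⁻¹ * (y : S)⁻¹ ∈ ⁅T, T⁆ := Subgroup.commutator_mem_commutator x.2 y.2
    have h1 := huni _ hx
    obtain ⟨n, hn, hn1⟩ := (isOfFinOrder_iff_pow_eq_one).mp (hNIU _ h1)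
    have h2 := NIU.eq_one_of_unipotent (ρ ((x : S) * y * (x : S)⁻¹ * (y : S)⁻¹) : Matrix (Fin d) (Fin d) F)
      ⟨d, h1⟩ n hn (by rw [← Units.val_pow_eq_pow_val, hn1, Units.val_one])
    have h3 : ρ ((x : S) * y * (x : S)⁻¹ * (y : S)⁻¹) = 1 := Units.ext h2
    have h4 : ((x : S) * y * (x : S)⁻¹ * (y : S)⁻¹) = 1 := hinj (by rw [h3, map_one])
    exact Subtype.ext (commutatorElement_eq_one_iff_mul_comm.mp h4 : (x : S) * y = y * x)
end

section
/- Let S be a polycyclic group which is NIU-linear, i.e. S admits a faithful representation into GL(d,F), for some positive integer d and field F, whose image has the property that every unipotent element has finite order. Then S is virtually abelian. -/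
open Matrix

theorem aux_pow_d {d : ℕ} {K : Type} [Field K] (M : Matrix (Fin d) (Fin d) K)
    (h : IsNilpotent M) : M ^ d = 0 := by
  have h1 := (Matrix.isNilpotent_charpoly_sub_pow_of_isNilpotent h).eq_zero
  rw [sub_eq_zero, Fintype.card_fin] at h1
  have h2 := Matrix.aeval_self_charpoly M
  rw [h1] at h2
  simpa using h2

theorem aux_nilp {K : Type} [Field K] [IsAlgClosed K] {B : Type} [CommRing B] [Algebra K B]
    [Module.Finite K B] (b : B) (h : ∀ φ : B →ₐ[K] K, φ b = 0) : IsNilpotent b := by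
  rw [nilpotent_iff_mem_prime]
  intro J hJ
  have hb := IsAlgClosed.algebraMap_bijective_of_isIntegral (k := K) (K := B ⧸ J)
  let e : K ≃ₐ[K] (B ⧸ J) := AlgEquiv.ofBijective (Algebra.ofId K (B ⧸ J)) hb
  have := h (e.symm.toAlgHom.comp (Ideal.Quotient.mkₐ K J))
  have h3 : e.symm (Ideal.Quotient.mk J b) = 0 := this
  rw [← Ideal.Quotient.eq_zero_iff_mem]
  simpa using h3

theorem aux_unip {d : ℕ} {K : Type} [Field K] [IsAlgClosed K]
    (B : Subalgebra K (Matrix (Fin d) (Fin d) K)) (hB : ∀ x ∈ B, ∀ y ∈ B, x * y = y * x)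
    (b : B) (h : ∀ φ : B →ₐ[K] K, φ b = 1) : ((b : Matrix (Fin d) (Fin d) K) - 1) ^ d = 0 := by
  let : CommRing B := { (inferInstance : Ring B) with
    mul_comm := fun x y => Subtype.ext (hB _ x.2 _ y.2) }
  have h1 : IsNilpotent (b - 1) := aux_nilp (K := K) _ (fun φ => by rw [map_sub, h φ, map_one, sub_self])
  apply aux_pow_d
  exact h1.map B.val

theorem aux_root {d : ℕ} {K : Type} [Field K]
    (B : Subalgebra K (Matrix (Fin d) (Fin d) K)) (b : B) (φ : B →ₐ[K] K) :
    (b : Matrix (Fin d) (Fin d) K).charpoly.IsRoot (φ b) := by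
  have h2 := Matrix.aeval_self_charpoly (b : Matrix (Fin d) (Fin d) K)
  have h3 : Polynomial.aeval b (b : Matrix (Fin d) (Fin d) K).charpoly = 0 := by
    apply Subtype.val_injective
    rw [← B.coe_val, ← Polynomial.aeval_algHom_apply]
    exact h2
  have h4 := congrArg φ h3
  rw [← Polynomial.aeval_algHom_apply, map_zero] at h4
  simpa [Polynomial.IsRoot, Polynomial.aeval_def] using h4

theorem aux_finHom {d : ℕ} {K : Type} [Field K]
    (B : Subalgebra K (Matrix (Fin d) (Fin d) K)) : Finite (B →ₐ[K] K) := inferInstance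

/-- commutator elements with a central power: eigenvalues are roots of unity -/
theorem aux_eig {d : ℕ} {K : Type} [Field K] {H : Type} [Group H]
    (ρ : H →* GL (Fin d) K) (x : H) (hx : x ∈ commutator H) (m : ℕ) 
    (hz : ∀ y, Commute (x ^ m) y) (μ : K)
    (hμ : ((ρ (x ^ m) : GL (Fin d) K) : Matrix (Fin d) (Fin d) K).charpoly.IsRoot μ) :
    μ ^ d.factorial = 1 := by
  let σ : H →* Module.End K (Fin d → K) :=
    ((Matrix.toLinAlgEquiv' : Matrix (Fin d) (Fin d) K ≃ₐ[K] _).toAlgHom : _ →* _).comp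
      ((Units.coeHom _).comp ρ)
  have hs : Module.End.HasEigenvalue (σ (x ^ m)) μ := by
    rw [Module.End.hasEigenvalue_iff_mem_spectrum]
    change μ ∈ spectrum K (Matrix.toLinAlgEquiv' _)
    rw [AlgEquiv.spectrum_eq, Matrix.mem_spectrum_iff_isRoot_charpoly]
    exact hμ
  let E := Module.End.eigenspace (σ (x ^ m)) μ
  have hE : ∀ y : H, ∀ v ∈ E, σ y v ∈ E := by
    intro y v hv
    rw [Module.End.mem_eigenspace_iff] at hv ⊢
    have := congrArg (fun f : Module.End K (Fin d → K) => f v) ((hz y).map σ).eq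
    simp only [Module.End.mul_apply] at this
    rw [this, hv, map_smul]
  let δ : H →* K := 
    { toFun := fun y => LinearMap.det ((σ y).restrict (hE y))
      map_one' := by
        convert LinearMap.det_id (A := K) (M := E)
        ext v
        simp
      map_mul' := fun y z => by
        rw [← LinearMap.det_comp]
        congr 1
        ext v
        simp }
  have h1 : δ x = 1 := by
    have := Abelianization.commutator_subset_ker δ.toHomUnits hx
    rw [MonoidHom.mem_ker] at this
    exact congrArg Units.val this
  have h2 : δ (x ^ m) = μ ^ Module.finrank K E := by
    have : (σ (x ^ m)).restrict (hE (x ^ m)) = μ • LinearMap.id := by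
      ext v : 2
      have := Module.End.mem_eigenspace_iff.1 v.2
      simpa using this
    change LinearMap.det ((σ (x ^ m)).restrict (hE (x ^ m))) = _
    rw [this, LinearMap.det_smul, LinearMap.det_id, mul_one]
  rw [map_pow, h1, one_pow] at h2
  have h3 : 0 < Module.finrank K E := by
    rw [Module.finrank_pos_iff, Submodule.nontrivial_iff_ne_bot]
    exact hs
  have h4 : Module.finrank K E ≤ d := by
    simpa using Submodule.finrank_le E
  obtain ⟨k, hk⟩ := Nat.dvd_factorial h3 h4
  rw [hk, pow_mul, ← h2, one_pow]

theorem aux_tors {d : ℕ} {K : Type} [Field K] [IsAlgClosed K] {H : Type} [Group H]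
    (ρ : H →* GL (Fin d) K)
    (hNIU : ∀ g : H, ((ρ g : Matrix (Fin d) (Fin d) K) - 1) ^ d = 0 → IsOfFinOrder g)
    (x : H) (hx : x ∈ commutator H) (m : ℕ) (hm : 0 < m)
    (hz : ∀ y, Commute (x ^ m) y) : IsOfFinOrder x := by
  have : IsOfFinOrder ((x ^ m) ^ d.factorial) := by
    apply hNIU
    let M : Matrix (Fin d) (Fin d) K := ((ρ (x ^ m) : GL (Fin d) K) : Matrix (Fin d) (Fin d) K)
    let B := Algebra.adjoin K {M}
    have hM : M ∈ B := Algebra.self_mem_adjoin_singleton K M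
    have := aux_unip B (fun y hy z hz => by
      have := Algebra.isMulCommutative_adjoin K (s := {M}) (by simp)
      exact setLike_mul_comm hy hz) ((⟨M, hM⟩ : B) ^ d.factorial) (fun φ => by
        rw [map_pow]
        exact aux_eig ρ x hx m hz _ (aux_root B ⟨M, hM⟩ φ))
    rw [map_pow]
    exact this
  rw [← pow_mul] at this
  exact this.of_pow (mul_pos hm (Nat.factorial_pos d)).ne'

theorem aux_finite {G : Type} [Group G] (D : Subgroup G) (hfg : D.FG)
    (hc : ∀ x ∈ D, ∀ y ∈ D, x * y = y * x) (ht : ∀ x ∈ D, IsOfFinOrder x) : Finite D := by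
  let : CommGroup D := { (inferInstance : Group D) with
    mul_comm := fun x y => Subtype.ext (hc _ x.2 _ y.2) }
  have : Group.FG D := (Group.fg_iff_subgroup_fg D).2 hfg
  apply CommGroup.finite_of_fg_isMulTorsion
  intro x
  exact Submonoid.isOfFinOrder_coe.1 (ht x x.2)

theorem aux_class {d : ℕ} {K : Type} [Field K] [IsAlgClosed K] {G : Type} [Group G]
    (hfg : ∀ H : Subgroup G, H.FG)
    (ρ : G →* GL (Fin d) K)
    (hNIU : ∀ g : G, ((ρ g : Matrix (Fin d) (Fin d) K) - 1) ^ d = 0 → IsOfFinOrder g)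
    (A : Subgroup G) [A.Normal] (hA : ∀ x ∈ A, ∀ y ∈ A, x * y = y * x) (a : G) (ha : a ∈ A) :
    (Set.range (fun g : G => g * a * g⁻¹)).Finite := by
  classical
  have htf : {x : G | x ∈ A ∧ IsOfFinOrder x}.Finite := by
    let D : Subgroup G :=
      { carrier := {x : G | x ∈ A ∧ IsOfFinOrder x}
        mul_mem' := fun {x y} hx hy => ⟨A.mul_mem hx.1 hy.1, 
          Commute.isOfFinOrder_mul (hA _ hx.1 _ hy.1) hx.2 hy.2⟩
        one_mem' := ⟨A.one_mem, IsOfFinOrder.one⟩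
        inv_mem' := fun {x} hx => ⟨A.inv_mem hx.1, hx.2.inv⟩ }
    have : Finite D := aux_finite D (hfg D) (fun x hx y hy => hA _ hx.1 _ hy.1) (fun x hx => hx.2)
    exact Set.toFinite (D : Set G)
  let r : G → Matrix (Fin d) (Fin d) K := fun g => (ρ g : Matrix (Fin d) (Fin d) K)
  have hr : ∀ x y, r (x * y) = r x * r y := fun x y => by simp [r]
  let B := Algebra.adjoin K (r '' (A : Set G))
  have hmem : ∀ x ∈ A, r x ∈ B := fun x hx => Algebra.subset_adjoin ⟨x, hx, rfl⟩
  have hB : ∀ x ∈ B, ∀ y ∈ B, x * y = y * x := by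
    have := Algebra.isMulCommutative_adjoin K (s := r '' (A : Set G)) (by
      rintro _ ⟨x, hx, rfl⟩ _ ⟨y, hy, rfl⟩
      rw [← hr, ← hr, hA x hx y hy])
    intro x hx y hy
    exact setLike_mul_comm hx hy
  have hconj : ∀ g : G, g * a * g⁻¹ ∈ A := fun g => ‹A.Normal›.conj_mem a ha g
  let Φ := B →ₐ[K] K
  have hΦ : Finite Φ := aux_finHom B
  let ev : G → Φ → K := fun x φ => if h : x ∈ A then φ ⟨r x, hmem x h⟩ else 0
  let R : Set K := {μ | (r a).charpoly.IsRoot μ}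
  have hR : R.Finite := Polynomial.finite_setOfPred_isRoot (Matrix.charpoly_monic _).ne_zero
  have hev : ∀ g, ev (g * a * g⁻¹) ∈ Set.pi Set.univ (fun _ : Φ => R) := by
    intro g φ _
    simp only [ev, dif_pos (hconj g)]
    have := aux_root B ⟨r (g * a * g⁻¹), hmem _ (hconj g)⟩ φ
    have h2 : (r (g * a * g⁻¹)).charpoly = (r a).charpoly := by
      have := Matrix.charpoly_units_conj (ρ g) (r a)
      rw [← this]
      congr 1
      simp [r]
    change (r (g * a * g⁻¹)).charpoly.IsRoot _ at this
    rw [h2] at this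
    exact this
  refine Set.Finite.of_finite_fibers ev ((Set.Finite.pi' (fun _ : Φ => hR)).subset ?_) ?_
  · rintro _ ⟨_, ⟨g, rfl⟩, rfl⟩ φ
    exact hev g φ trivial
  · rintro _ ⟨_, ⟨g, rfl⟩, rfl⟩
    have hb := hconj g
    dsimp only
    generalize g * a * g⁻¹ = b at hb
    refine (htf.image (fun t => b * t)).subset ?_
    rintro _ ⟨⟨k, rfl⟩, hk⟩
    have hc := hconj k
    dsimp only at hk ⊢
    generalize k * a * k⁻¹ = c at hc hk
    have hbc : b⁻¹ * c ∈ A := A.mul_mem (A.inv_mem hb) hc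
    refine ⟨b⁻¹ * c, ⟨hbc, hNIU _ ?_⟩, by group⟩
    refine aux_unip B hB ⟨r (b⁻¹ * c), hmem _ hbc⟩ (fun φ => ?_)
    have h1 : φ ⟨r c, hmem c hc⟩ = φ ⟨r b, hmem b hb⟩ := by
      have := congrFun (show ev c = ev b from hk) φ
      simpa [ev, hb, hc] using this
    have h2 : (⟨r (b⁻¹ * c), hmem _ hbc⟩ : B) = ⟨r b⁻¹, hmem _ (A.inv_mem hb)⟩ * ⟨r c, hmem c hc⟩ :=
      Subtype.ext (hr _ _)
    have h3 : (⟨r b⁻¹, hmem _ (A.inv_mem hb)⟩ : B) * ⟨r b, hmem b hb⟩ = 1 := by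
      apply Subtype.ext
      change r b⁻¹ * r b = 1
      rw [← hr]; simp [r]
    rw [h2, map_mul, h1, ← map_mul, h3, map_one]

theorem aux_centralizer {G : Type} [Group G] (A : Subgroup G) (hA : A.FG)
    (h : ∀ a ∈ A, (Set.range (fun g : G => g * a * g⁻¹)).Finite) :
    (Subgroup.centralizer (A : Set G)).FiniteIndex := by
  obtain ⟨s, rfl⟩ := hA
  rw [Subgroup.centralizer_closure, Subgroup.centralizer_eq_iInf]
  refine Subgroup.finiteIndex_iInf' (s := s) _ ?_
  intro a ha
  have hf := h a (Subgroup.subset_closure ha)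
  rw [Subgroup.centralizer_eq_comap_stabilizer]
  constructor
  change (Subgroup.comap (ConjAct.toConjAct : G ≃* ConjAct G).toMonoidHom
    (MulAction.stabilizer (ConjAct G) a)).index ≠ 0
  rw [Subgroup.index_comap_of_surjective _ (ConjAct.toConjAct.surjective), MulAction.index_stabilizer]
  have hfo : (MulAction.orbit (ConjAct G) a).Finite := by
    refine hf.subset ?_
    rintro _ ⟨g, rfl⟩
    exact ⟨ConjAct.ofConjAct g, by simp [ConjAct.smul_def]⟩
  exact ((Set.ncard_pos hfo).2 ⟨a, MulAction.mem_orbit_self a⟩).ne'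

theorem aux_key {d : ℕ} {K : Type} [Field K] [IsAlgClosed K] {G : Type} [Group G]
    (hfg : ∀ H : Subgroup G, H.FG)
    (ρ : G →* GL (Fin d) K)
    (hNIU : ∀ g : G, ((ρ g : Matrix (Fin d) (Fin d) K) - 1) ^ d = 0 → IsOfFinOrder g)
    (T : Subgroup G) (hT : ∀ x ∈ T, ∀ y ∈ T, x * y = y * x)
    (hi : T.relIndex (commutator G) ≠ 0) :
    ∃ T : Subgroup G, T.index ≠ 0 ∧ ∀ x ∈ T, ∀ y ∈ T, x * y = y * x := by
  let m := (T.relIndex (commutator G)).factorial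
  have hm : 0 < m := Nat.factorial_pos _
  have hpow : ∀ x ∈ commutator G, x ^ m ∈ T := fun x hx =>
    (Subgroup.pow_mem_of_relIndex_ne_zero_of_dvd hi hx
      (fun k h1 h2 => Nat.dvd_factorial h1 h2)).1
  let A : Subgroup G := Subgroup.closure ((fun x => x ^ m) '' (commutator G : Set G))
  have hAT : A ≤ T := by
    rw [Subgroup.closure_le]
    rintro _ ⟨x, hx, rfl⟩
    exact hpow x hx
  have hAc : ∀ x ∈ A, ∀ y ∈ A, x * y = y * x := fun x hx y hy => hT _ (hAT hx) _ (hAT hy)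
  have hAn : A.Normal := by
    refine ⟨fun x hx g => ?_⟩
    have : A ≤ A.comap (MulAut.conj g).toMonoidHom := by
      refine (Subgroup.closure_le _).2 ?_
      rintro _ ⟨x, hx, rfl⟩
      refine Subgroup.subset_closure ⟨g * x * g⁻¹, ?_, ?_⟩
      · exact Subgroup.Normal.conj_mem inferInstance x hx g
      · simp
    exact this hx
  let C := Subgroup.centralizer (A : Set G)
  have hC : C.FiniteIndex := aux_centralizer A (hfg A) (aux_class hfg ρ hNIU A hAc)
  have htors : ∀ x : C, x ∈ commutator C → IsOfFinOrder x := by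
    intro x hx
    refine aux_tors (ρ.comp C.subtype) (fun g hg => ?_) x hx m hm ?_
    · exact Submonoid.isOfFinOrder_coe.1 (hNIU g hg)
    · intro y
      have hxG : (x : G) ∈ commutator G := by
        have : (commutator C).map C.subtype ≤ commutator G := by
          rw [commutator_def, commutator_def, Subgroup.map_commutator]
          exact Subgroup.commutator_mono le_top le_top
        exact this ⟨x, hx, rfl⟩
      have hxA : (x : G) ^ m ∈ A := Subgroup.subset_closure ⟨_, hxG, rfl⟩
      exact Subtype.ext (Subgroup.mem_centralizer_iff.1 y.2 _ hxA)
  let D := (commutator C).map C.subtype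
  have hD : D ≤ commutator G := by
    simp only [D]
    rw [commutator_def, commutator_def, Subgroup.map_commutator]
    exact Subgroup.commutator_mono le_top le_top
  have hDt : ∀ x ∈ D, IsOfFinOrder x := by
    rintro _ ⟨x, hx, rfl⟩
    exact Submonoid.isOfFinOrder_coe.2 (htors x hx)
  have hDfin : Finite D := by
    have h1 : Finite (T ⊓ D : Subgroup G) := aux_finite _ (hfg _)
      (fun x hx y hy => hT _ hx.1 _ hy.1) (fun x hx => hDt x hx.2)
    have h2 : T.relIndex D ≠ 0 := fun h => hi (Subgroup.relIndex_eq_zero_of_le_right hD h)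
    rw [← Subgroup.inf_relIndex_right] at h2
    have h3 := Subgroup.card_mul_index ((T ⊓ D).subgroupOf D)
    apply Nat.finite_of_card_ne_zero
    rw [← h3]
    refine mul_ne_zero ?_ h2
    have : Finite ((T ⊓ D).subgroupOf D) :=
      Finite.of_equiv _ (Subgroup.subgroupOfEquivOfLe (inf_le_right : T ⊓ D ≤ D)).symm.toEquiv
    exact Nat.card_pos.ne'
  have hCfin : Finite (commutator C) :=
    Finite.of_equiv _ (Subgroup.equivMapOfInjective (commutator C) C.subtype
      C.subtype_injective).symm.toEquiv
  have : Finite (commutatorSet C) := by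
    refine (Set.toFinite ((commutator C : Subgroup C) : Set C)).subset ?_
    rw [commutator_eq_closure]
    exact Subgroup.subset_closure
  have : Group.FG C := (Group.fg_iff_subgroup_fg C).2 (hfg C)
  have hZ : (Subgroup.center C).FiniteIndex := inferInstance
  refine ⟨(Subgroup.center C).map C.subtype, ?_, ?_⟩
  · rw [Subgroup.index_map_subtype]
    exact mul_ne_zero hZ.index_ne_zero hC.index_ne_zero
  · rintro _ ⟨x, hx, rfl⟩ _ ⟨y, hy, rfl⟩
    exact congrArg Subtype.val (Subgroup.mem_center_iff.1 hy x)

theorem aux_main {d : ℕ} {K : Type} [Field K] [IsAlgClosed K] {G : Type} [Group G]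
    (hsolv : IsSolvable G) (hfg : ∀ H : Subgroup G, H.FG)
    (ρ : G →* GL (Fin d) K)
    (hNIU : ∀ g : G, ((ρ g : Matrix (Fin d) (Fin d) K) - 1) ^ d = 0 → IsOfFinOrder g) :
    ∃ T : Subgroup G, T.index ≠ 0 ∧ ∀ x ∈ T, ∀ y ∈ T, x * y = y * x := by
  obtain ⟨n, hn⟩ := hsolv
  have step : ∀ k ≤ n, ∃ T : Subgroup G, T.relIndex (derivedSeries G (n - k)) ≠ 0 ∧
      ∀ x ∈ T, ∀ y ∈ T, x * y = y * x := by
    intro k hk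
    induction k with
    | zero =>
      refine ⟨⊥, ?_, ?_⟩
      · rw [Nat.sub_zero, hn]; simp
      · intro x hx y hy
        rw [Subgroup.mem_bot.1 hx, Subgroup.mem_bot.1 hy]
    | succ k ih =>
      obtain ⟨T, hT, hTc⟩ := ih (by omega)
      have e : n - k = (n - (k + 1)) + 1 := by omega
      rw [e, derivedSeries_succ] at hT
      generalize derivedSeries G (n - (k + 1)) = H at hT ⊢
      obtain ⟨T2, h1, h2⟩ := aux_key (G := H) (fun L => by
          have h := (Group.fg_iff_subgroup_fg _).2 (hfg (L.map H.subtype))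
          rw [← Group.fg_iff_subgroup_fg]
          exact Group.fg_of_surjective (f := (L.equivMapOfInjective H.subtype
            H.subtype_injective).symm.toMonoidHom) (MulEquiv.surjective _)) (ρ.comp H.subtype)
        (fun g hg => Submonoid.isOfFinOrder_coe.1 (hNIU g hg)) (T.subgroupOf H)
        (fun x hx y hy => Subtype.ext (hTc _ hx _ hy)) (by
          rw [← Subgroup.relIndex_map_map_of_injective _ _ H.subtype_injective, commutator_def,
            Subgroup.map_commutator, ← MonoidHom.range_eq_map, Subgroup.range_subtype,
            Subgroup.subgroupOf_map_subtype]
          intro h0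
          apply hT
          rw [← Subgroup.inf_relIndex_right] at h0 ⊢
          rwa [inf_assoc, inf_eq_right.2 (Subgroup.commutator_le_self H)] at h0)
      refine ⟨T2.map H.subtype, ?_, ?_⟩
      · rw [← Subgroup.relIndex_top_right, ← Subgroup.relIndex_map_map_of_injective _ _ H.subtype_injective, 
          ← MonoidHom.range_eq_map, Subgroup.range_subtype] at h1
        exact h1
      · rintro _ ⟨x, hx, rfl⟩ _ ⟨y, hy, rfl⟩
        exact congrArg Subtype.val (h2 x hx y hy)
  obtain ⟨T, h1, h2⟩ := step n le_rfl
  refine ⟨T, ?_, h2⟩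
  simpa using h1

/-- A polycyclic (i.e. solvable with every subgroup finitely generated) NIU-linear group
is virtually abelian. -/
theorem stmt_11 {S : Type} [Group S] (hsolv : IsSolvable S)
    (hpoly : ∀ H : Subgroup S, H.FG)
    {d : ℕ} (hd : 0 < d) {F : Type} [Field F] (ρ : S →* GL (Fin d) F)
    (hinj : Function.Injective ρ)
    (hNIU : ∀ g : S, IsUnipotent (ρ g) → IsOfFinOrder (ρ g)) :
    ∃ T : Subgroup S, T.FiniteIndex ∧ ∀ x y : ↥T, x * y = y * x := by
  let f : F →+* AlgebraicClosure F := algebraMap F (AlgebraicClosure F)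
  obtain ⟨T, h1, h2⟩ := aux_main (K := AlgebraicClosure F) hsolv hpoly
    ((Matrix.GeneralLinearGroup.map f).comp ρ) (fun g hg => by
      have h3 : IsUnipotent (ρ g) := by
        have h4 : f.mapMatrix ((((ρ g : GL (Fin d) F) : Matrix (Fin d) (Fin d) F) - 1) ^ d) = 0 := by
          rw [map_pow, map_sub, map_one]
          exact hg
        have hfi : Function.Injective (f.mapMatrix : Matrix (Fin d) (Fin d) F →+* _) :=
          Matrix.map_injective f.injective
        exact (map_eq_zero_iff _ hfi).1 h4
      exact (Function.Injective.isOfFinOrder_iff hinj).1 (hNIU g h3))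
  exact ⟨T, ⟨h1⟩, fun x y => Subtype.ext (h2 _ x.2 _ y.2)⟩
end

section
/- Let G be a finitely generated group admitting a faithful representation into GL(d,F), for some positive integer d and field F, with NIU-linear image, and let A be a finitely generated abelian subgroup of G. Then A is undistorted in G: for any finite generating set S of G and any finite generating set T of A there exists a constant c > 0 such that l_S(a) ≥ c · l_T(a) for all a ∈ A, where l_S and l_T denote word lengths. -/
open Matrix

/-- The word length of `g` with respect to a generating set `S`: the least `n` such that
`g` is a product of `n` elements of `S ∪ S⁻¹`. -/
noncomputable def wordLength {G : Type*} [Group G] (S : Set G) (g : G) : ℕ :=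
  sInf {n | ∃ l : List G, l.length = n ∧ (∀ x ∈ l, x ∈ S ∨ x⁻¹ ∈ S) ∧ l.prod = g}

theorem lat_pigeon {r : ℕ} (v : Fin r → ℤ) (n : ℕ) (hn : 0 < n) (hv : ∃ i, (v i).natAbs = n)
    (Q : ℕ) (hQ : 0 < Q) :
    ∃ j : ℕ, 0 < j ∧ j ≤ Q ^ r ∧ ∃ w : Fin r → ℤ, w ≠ 0 ∧
      ∀ i, (Q : ℤ) * |n * w i - j * v i| ≤ n := by
  have hn' : (0 : ℤ) < n := by exact_mod_cast hn
  have hQ' : (0 : ℤ) < Q := by exact_mod_cast hQ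
  let f : Fin (Q ^ r + 1) → (Fin r → Fin Q) := fun j i =>
    ⟨((((j : ℤ) * v i) % n * Q) / n).toNat, by
      have h1 : ((j : ℤ) * v i) % n < n := Int.emod_lt_of_pos _ hn'
      have h0 : 0 ≤ ((j : ℤ) * v i) % n := Int.emod_nonneg _ hn'.ne'
      have h2 : (((j : ℤ) * v i) % n * Q) / n < Q := by
        rw [Int.ediv_lt_iff_lt_mul hn']; nlinarith
      have h3 : 0 ≤ (((j : ℤ) * v i) % n * Q) / n := by positivity
      omega⟩
  obtain ⟨j1, j2, hlt, hf⟩ : ∃ j1 j2, j1 < j2 ∧ f j1 = f j2 := by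
    obtain ⟨a, b, hab, h⟩ := Fintype.exists_ne_map_eq_of_card_lt f (by simp)
    rcases lt_or_gt_of_ne hab with h' | h'
    · exact ⟨a, b, h', h⟩
    · exact ⟨b, a, h', h.symm⟩
  have hlt' : (j1 : ℕ) < j2 := hlt
  have key : ∀ i, (Q : ℤ) * |n * (((j2 : ℕ) : ℤ) * v i / n - ((j1 : ℕ) : ℤ) * v i / n)
      - ((j2 - j1 : ℕ) : ℤ) * v i| < n := by
    intro i
    have h := congrArg Fin.val (congrFun hf i)
    simp only [f] at h
    have e1 := Int.emod_add_mul_ediv (((j1 : ℕ) : ℤ) * v i) n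
    have e2 := Int.emod_add_mul_ediv (((j2 : ℕ) : ℤ) * v i) n
    have p1 : 0 ≤ (((j1 : ℕ) : ℤ) * v i) % n := Int.emod_nonneg _ hn'.ne'
    have p2 : 0 ≤ (((j2 : ℕ) : ℤ) * v i) % n := Int.emod_nonneg _ hn'.ne'
    set x := (((j1 : ℕ) : ℤ) * v i) % n with hx
    set y := (((j2 : ℕ) : ℤ) * v i) % n with hy
    have q1 : 0 ≤ x * Q / n := by positivity
    have q2 : 0 ≤ y * Q / n := by positivity
    have h' : x * Q / n = y * Q / n := by omega
    have d1 := Int.emod_add_mul_ediv (x * Q) n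
    have d2 := Int.emod_add_mul_ediv (y * Q) n
    have := Int.emod_nonneg (x * Q) hn'.ne'
    have := Int.emod_nonneg (y * Q) hn'.ne'
    have := Int.emod_lt_of_pos (x * Q) hn'
    have := Int.emod_lt_of_pos (y * Q) hn'
    rw [h'] at d1
    have : (n : ℤ) * (((j2 : ℕ) : ℤ) * v i / n - ((j1 : ℕ) : ℤ) * v i / n)
      - ((j2 - j1 : ℕ) : ℤ) * v i = x - y := by
      push_cast [hlt'.le]
      linarith
    rw [this, show (Q : ℤ) * |x - y| = |(Q : ℤ) * (x - y)| by rw [abs_mul, abs_of_pos hQ'], abs_lt]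
    constructor <;> nlinarith
  refine ⟨j2 - j1, by omega, by omega, fun i => ((j2 : ℕ) : ℤ) * v i / n - ((j1 : ℕ) : ℤ) * v i / n,
    ?_, fun i => (key i).le⟩
  intro h0
  obtain ⟨i, hi⟩ := hv
  have h1 := key i
  have h2 := congrFun h0 i
  simp only [Pi.zero_apply] at h2
  rw [h2] at h1
  have h3 : |v i| = n := by rw [← hi]; simp
  rw [mul_zero, zero_sub, abs_neg, abs_mul, h3, abs_of_nonneg (by positivity)] at h1
  have : (1 : ℤ) ≤ ((j2 - j1 : ℕ) : ℤ) := by omega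
  have : 1 ≤ (Q : ℤ) * ((j2 - j1 : ℕ) : ℤ) := by nlinarith
  nlinarith

theorem lat_upper {r : ℕ} {H : Type*} [AddCommGroup H] [Finite H]
    (l : (Fin r → ℤ) × H → ℕ) (l0 : l 0 = 0)
    (ladd : ∀ v w, l (v + w) ≤ l v + l w) (lneg : ∀ v, l (-v) ≤ l v) :
    ∃ K : ℕ, ∀ n : ℕ, ∀ v, (∀ i, (v.1 i).natAbs ≤ n) → l v ≤ K * n + K := by
  have lsum : ∀ (s : Finset (Fin r)) (g : Fin r → (Fin r → ℤ) × H),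
      l (∑ i ∈ s, g i) ≤ ∑ i ∈ s, l (g i) := by
    intro s g
    exact Finset.le_sum_of_subadditive l l0.le ladd s g
  have lnat : ∀ (k : ℕ) v, l (k • v) ≤ k * l v := by
    intro k v
    induction k with
    | zero => simp [l0]
    | succ k ih => rw [succ_nsmul]; calc _ ≤ _ := ladd _ _
                   _ ≤ _ := by linarith
  have lint : ∀ (k : ℤ) v, l (k • v) ≤ k.natAbs * l v := by
    intro k v
    obtain ⟨n, rfl | rfl⟩ := Int.eq_nat_or_neg k
    · rw [natCast_zsmul]; simpa using lnat n v
    · rw [neg_zsmul, natCast_zsmul]; simpa using (lneg _).trans (lnat n v)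
  obtain ⟨M, hM⟩ : ∃ M, ∀ h : H, l (0, h) ≤ M := by
    obtain ⟨M, hM⟩ := (Set.finite_range (fun h : H => l (0, h))).bddAbove
    exact ⟨M, fun h => hM ⟨h, rfl⟩⟩
  let e : Fin r → (Fin r → ℤ) × H := fun i => (Pi.single i 1, 0)
  refine ⟨∑ i, l (e i) + M, fun n v hv => ?_⟩
  have hvv : v = ∑ i, v.1 i • e i + (0, v.2) := by
    ext x
    · simp [e, Prod.fst_sum, Finset.sum_apply, Pi.single_apply]
    · simp [e, Prod.snd_sum]
  calc l v = l (∑ i, v.1 i • e i + (0, v.2)) := by rw [← hvv]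
    _ ≤ l (∑ i, v.1 i • e i) + l (0, v.2) := ladd _ _
    _ ≤ ∑ i, n * l (e i) + M := by
        refine add_le_add ((lsum _ _).trans (Finset.sum_le_sum fun i _ => ?_)) (hM _)
        exact (lint _ _).trans (Nat.mul_le_mul_right _ (hv i))
    _ ≤ _ := by rw [← Finset.mul_sum]; nlinarith [Nat.zero_le (M * n), Nat.zero_le (∑ i, l (e i))]

theorem lat_main {r : ℕ} {H : Type*} [AddCommGroup H] [Finite H]
    (l m : (Fin r → ℤ) × H → ℕ) (l0 : l 0 = 0) (l1 : ∀ v, l v = 0 → v = 0)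
    (ladd : ∀ v w, l (v + w) ≤ l v + l w) (lneg : ∀ v, l (-v) ≤ l v)
    (m0 : m 0 = 0)
    (madd : ∀ v w, m (v + w) ≤ m v + m w) (mneg : ∀ v, m (-v) ≤ m v)
    (N : ℕ) (hN : ∀ v, v.1 ≠ 0 → ∀ k : ℕ, k ≤ N * l (k • v)) :
    ∃ C : ℕ, ∀ v, m v ≤ C * l v := by
  obtain ⟨K, hK⟩ := lat_upper l l0 ladd lneg
  obtain ⟨K', hK'⟩ := lat_upper m m0 madd mneg
  have lnat : ∀ (k : ℕ) v, l (k • v) ≤ k * l v := by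
    intro k v
    induction k with
    | zero => simp [l0]
    | succ k ih => rw [succ_nsmul]; calc _ ≤ _ := ladd _ _
                   _ ≤ _ := by linarith
  set Q := 2 * N * K + 1 with hQ
  refine ⟨K' * (2 * N * Q ^ r + 2 * N * K + 1), fun v => ?_⟩
  rcases Nat.eq_zero_or_pos (l v) with hz | hpos
  · rw [l1 v hz, m0]; exact Nat.zero_le _
  obtain ⟨n, hvn, hn⟩ : ∃ n, (∀ i, (v.1 i).natAbs ≤ n) ∧
      (n = 0 ∨ ∃ i, (v.1 i).natAbs = n) := by
    refine ⟨Finset.univ.sup fun i => (v.1 i).natAbs,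
      fun i => Finset.le_sup (f := fun i => (v.1 i).natAbs) (Finset.mem_univ i), ?_⟩
    rcases isEmpty_or_nonempty (Fin r) with h | h
    · left; simp
    · right
      obtain ⟨i, -, hi⟩ := Finset.exists_mem_eq_sup Finset.univ Finset.univ_nonempty
        (fun i => (v.1 i).natAbs)
      exact ⟨i, hi.symm⟩
  have hb : n ≤ 2 * N * Q ^ r * l v + 2 * N * K := by
    rcases Nat.eq_zero_or_pos n with h0 | h0
    · simp [h0]
    obtain ⟨j, hj, hjQ, w, hw, hkey⟩ := lat_pigeon v.1 n h0 (hn.resolve_left h0.ne') Q (by omega)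
    have h1 := hN (w, 0) hw n
    have h2 : n • ((w, 0) : (Fin r → ℤ) × H) = j • v + (n • ((w, 0) : (Fin r → ℤ) × H) - j • v) := by
      abel
    have h3 : l (n • ((w, 0) : (Fin r → ℤ) × H) - j • v) ≤ K * (n / Q) + K := by
      apply hK
      intro i
      rw [Nat.le_div_iff_mul_le (by omega)]
      have := hkey i
      have e : ((n • ((w, 0) : (Fin r → ℤ) × H) - j • v).1 i) = n * w i - j * v.1 i := by
        simp
      rw [e]
      zify
      linarith
    have h4 : l (n • ((w, 0) : (Fin r → ℤ) × H)) ≤ j * l v + (K * (n / Q) + K) := by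
      rw [h2]; exact (ladd _ _).trans (add_le_add (lnat _ _) h3)
    have h5 : j * l v ≤ Q ^ r * l v := Nat.mul_le_mul_right _ hjQ
    have h6 : 2 * N * K * (n / Q) ≤ n := by
      have := Nat.div_mul_le_self n Q
      nlinarith [Nat.zero_le (n / Q)]
    have h7 : N * l (n • ((w, 0) : (Fin r → ℤ) × H)) ≤ N * (Q ^ r * l v + (K * (n / Q) + K)) :=
      Nat.mul_le_mul_left _ (by omega)
    nlinarith
  have hm := hK' n v hvn
  have h8 : n + 1 ≤ (2 * N * Q ^ r + 2 * N * K + 1) * l v := by nlinarith [Nat.zero_le (N * K)]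
  calc m v ≤ K' * (n + 1) := by linarith
    _ ≤ _ := by rw [mul_assoc]; exact Nat.mul_le_mul_left _ h8

section WL
variable {G : Type*} [Group G]

theorem wl_le {S : Set G} {g : G} (l : List G) (hl : ∀ x ∈ l, x ∈ S ∨ x⁻¹ ∈ S)
    (hp : l.prod = g) : wordLength S g ≤ l.length :=
  Nat.sInf_le ⟨l, rfl, hl, hp⟩

theorem wl_exists {S : Set G} {g : G} (hg : g ∈ Subgroup.closure S) :
    ∃ l : List G, l.length = wordLength S g ∧ (∀ x ∈ l, x ∈ S ∨ x⁻¹ ∈ S) ∧ l.prod = g := by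
  have : {n | ∃ l : List G, l.length = n ∧ (∀ x ∈ l, x ∈ S ∨ x⁻¹ ∈ S) ∧ l.prod = g}.Nonempty := by
    rw [← Subgroup.mem_toSubmonoid, Subgroup.closure_toSubmonoid] at hg
    obtain ⟨l, h1, h2⟩ := Submonoid.exists_list_of_mem_closure hg
    exact ⟨l.length, l, rfl, h1, h2⟩
  exact Nat.sInf_mem this

theorem wl_one (S : Set G) : wordLength S 1 = 0 :=
  Nat.le_zero.mp (wl_le [] (by simp) (by simp))

theorem wl_eq_zero {S : Set G} {g : G} (hg : g ∈ Subgroup.closure S) (h : wordLength S g = 0) :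
    g = 1 := by
  obtain ⟨l, h1, -, h3⟩ := wl_exists hg
  rw [h, List.length_eq_zero_iff] at h1
  rw [← h3, h1, List.prod_nil]

theorem wl_mul {S : Set G} {g h : G} (hg : g ∈ Subgroup.closure S) (hh : h ∈ Subgroup.closure S) :
    wordLength S (g * h) ≤ wordLength S g + wordLength S h := by
  obtain ⟨l, h1, h2, h3⟩ := wl_exists hg
  obtain ⟨l', h1', h2', h3'⟩ := wl_exists hh
  rw [← h1, ← h1', ← List.length_append]
  refine wl_le _ ?_ (by rw [List.prod_append, h3, h3'])
  intro x hx
  rcases List.mem_append.mp hx with hx | hx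
  · exact h2 x hx
  · exact h2' x hx

theorem wl_inv {S : Set G} {g : G} (hg : g ∈ Subgroup.closure S) :
    wordLength S g⁻¹ ≤ wordLength S g := by
  obtain ⟨l, h1, h2, h3⟩ := wl_exists hg
  have : (l.map (·⁻¹)).reverse.length = wordLength S g := by simp [h1]
  rw [← this]
  refine wl_le _ ?_ (by rw [← List.prod_inv_reverse, h3])
  intro x hx
  simp only [List.mem_reverse, List.mem_map] at hx
  obtain ⟨y, hy, rfl⟩ := hx
  rw [inv_inv]
  exact (h2 y hy).symm

theorem wl_pow {S : Set G} {g : G} (hg : g ∈ Subgroup.closure S) (k : ℕ) :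
    wordLength S (g ^ k) ≤ k * wordLength S g := by
  induction k with
  | zero => simp [wl_one]
  | succ k ih =>
    rw [pow_succ]
    have := wl_mul (pow_mem hg k) hg
    linarith

theorem undist_of_translation (A : Subgroup G)
    (hab : ∀ a b : G, a ∈ A → b ∈ A → a * b = b * a) (hAfg : A.FG)
    (S : Set G) (hS : Subgroup.closure S = ⊤) (T : Set G) (hT : Subgroup.closure T = A)
    (N : ℕ) (hN : ∀ g : G, ¬ IsOfFinOrder g → ∀ k, k ≤ N * wordLength S (g ^ k)) :
    ∃ c : ℝ, 0 < c ∧ ∀ a ∈ A, c * (wordLength T a : ℝ) ≤ (wordLength S a : ℝ) := by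
  have hS' : ∀ g, g ∈ Subgroup.closure S := by simp [hS]
  letI : CommGroup A := { (inferInstance : Group A) with
    mul_comm := fun a b => Subtype.ext (hab a b a.2 b.2) }
  haveI : Group.FG A := (Group.fg_iff_subgroup_fg A).mpr hAfg
  obtain ⟨r, ι, _, p, hp, e, ⟨φ⟩⟩ := AddCommGroup.equiv_free_prod_directSum_zmod (Additive A)
  haveI : ∀ i, NeZero (p i ^ e i) := fun i => ⟨pow_ne_zero _ (hp i).ne_zero⟩
  haveI : Finite (DirectSum ι fun i => ZMod (p i ^ e i)) := by
    classical
    exact Finite.of_equiv _ (DirectSum.addEquivProd (fun i => ZMod (p i ^ e i))).symm.toEquiv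
  let ψ : (Fin r → ℤ) × (DirectSum ι fun i => ZMod (p i ^ e i)) ≃+ Additive A :=
    (AddEquiv.prodCongr (Finsupp.linearEquivFunOnFinite ℤ ℤ (Fin r)).symm.toAddEquiv
      (AddEquiv.refl _)).trans φ.symm
  let θ : (Fin r → ℤ) × (DirectSum ι fun i => ZMod (p i ^ e i)) → G := fun v => ((ψ v).toMul : A)
  have hθA : ∀ v, θ v ∈ Subgroup.closure T := fun v => by rw [hT]; exact ((ψ v).toMul).2
  have θadd : ∀ v w, θ (v + w) = θ v * θ w := fun v w => by simp [θ, toMul_add]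
  have θneg : ∀ v, θ (-v) = (θ v)⁻¹ := fun v => by simp only [θ, map_neg, toMul_neg]; rfl
  have θ0 : θ 0 = 1 := by simp [θ]
  have θinj : ∀ v, θ v = 1 → v = 0 := by
    intro v hv
    have h1 : (ψ v).toMul = (1 : A) := Subtype.ext hv
    have h2 : ψ v = 0 := h1
    simpa using h2
  have θn : ∀ (k : ℕ) v, θ (k • v) = (θ v) ^ k := by
    intro k v
    induction k with
    | zero => simp [θ0]
    | succ k ih => rw [succ_nsmul, θadd, ih, pow_succ]
  obtain ⟨C, hC⟩ := lat_main (fun v => wordLength S (θ v)) (fun v => wordLength T (θ v))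
    (by simp only [θ0, wl_one]) (fun v hv => θinj v (wl_eq_zero (hS' _) hv))
    (fun v w => by simp only [θadd]; exact wl_mul (hS' _) (hS' _))
    (fun v => by simp only [θneg]; exact wl_inv (hS' _))
    (by simp only [θ0, wl_one])
    (fun v w => by simp only [θadd]; exact wl_mul (hθA _) (hθA _))
    (fun v => by simp only [θneg]; exact wl_inv (hθA _)) N
    (fun v hv k => by
      simp only [θn]
      apply hN
      intro hfin
      obtain ⟨m, hm, h⟩ := isOfFinOrder_iff_pow_eq_one.mp hfin
      rw [← θn] at h
      have h2 := congrArg Prod.fst (θinj _ h)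
      rw [Prod.smul_fst, Prod.fst_zero, smul_eq_zero] at h2
      exact h2.elim hm.ne' hv)
  refine ⟨1 / ((C : ℝ) + 1), by positivity, fun a ha => ?_⟩
  obtain ⟨v, hv⟩ := ψ.surjective (Additive.ofMul (⟨a, ha⟩ : A))
  have hav : θ v = a := by simp [θ, hv]
  have h := hC v
  simp only [hav] at h
  rw [one_div, inv_mul_le_iff₀ (by positivity)]
  have h' : (wordLength T a : ℝ) ≤ C * wordLength S a := by exact_mod_cast h
  nlinarith [(Nat.cast_nonneg (wordLength S a) : (0 : ℝ) ≤ _)]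

end WL

theorem coeff_integral {O E ι : Type*} [CommRing O] [Field E] [Algebra O E] [Fintype ι]
    [DecidableEq ι] (M : Matrix ι ι E) (g : E) (N k : ℕ) (hN : 0 < N) (hk : 0 < k)
    (P : Matrix ι ι O) (hP : P.map (algebraMap O E) = g ^ k • M ^ (N * k))
    (i : ℕ) (hi : i ≤ Fintype.card ι) :
    IsIntegral O (M.charpoly.coeff i ^ N * g ^ (Fintype.card ι - i)) := by
  classical
  let L := AlgebraicClosure E
  let A : Matrix ι ι L := M.map (algebraMap E L)
  obtain ⟨γ, hγ⟩ := IsAlgClosed.exists_pow_nat_eq (algebraMap E L g) hN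
  have hA : A.charpoly = M.charpoly.map (algebraMap E L) := Matrix.charpoly_map M (algebraMap E L)
  have hIntg : ∀ x ∈ A.charpoly.roots, IsIntegral O (γ * x) := by
    intro x hx
    have hx1 : x ∈ spectrum L A := by
      rw [Matrix.mem_spectrum_iff_isRoot_charpoly]
      exact Polynomial.isRoot_of_mem_roots hx
    have hx2 := spectrum.subset_polynomial_aeval A
      (Polynomial.C (algebraMap E L (g ^ k)) * Polynomial.X ^ (N * k)) ⟨x, hx1, rfl⟩
    have hPA : P.map (algebraMap O L) = algebraMap E L (g ^ k) • A ^ (N * k) := by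
      have : P.map (algebraMap O L) = (P.map (algebraMap O E)).map (algebraMap E L) := by
        ext a b
        simp [IsScalarTower.algebraMap_apply O E L]
      rw [this, hP]
      have h2 : A ^ (N * k) = (M ^ (N * k)).map (algebraMap E L) := by
        have := map_pow (RingHom.mapMatrix (m := ι) (algebraMap E L)) M (N * k)
        exact this.symm
      rw [h2]
      ext a b
      simp
    have h3 : Polynomial.aeval A (Polynomial.C (algebraMap E L (g ^ k)) * Polynomial.X ^ (N * k))
        = P.map (algebraMap O L) := by
      rw [hPA, map_mul, Polynomial.aeval_C, Polynomial.aeval_X_pow, Algebra.smul_def]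
    rw [h3, Matrix.mem_spectrum_iff_isRoot_charpoly, Matrix.charpoly_map] at hx2
    have h4 : IsIntegral O (algebraMap E L (g ^ k) * x ^ (N * k)) := by
      refine ⟨P.charpoly, Matrix.charpoly_monic P, ?_⟩
      have := hx2
      simpa [Polynomial.IsRoot, Polynomial.eval_map] using this
    have h5 : (γ * x) ^ (N * k) = algebraMap E L (g ^ k) * x ^ (N * k) := by
      rw [mul_pow, pow_mul, hγ, map_pow]
    exact IsIntegral.of_pow (Nat.mul_pos hN hk) (h5 ▸ h4)
  have hcard : A.charpoly.roots.card = A.charpoly.natDegree :=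
    (Polynomial.splits_iff_card_roots).mp (IsAlgClosed.splits _)
  have hdeg : A.charpoly.natDegree = Fintype.card ι := Matrix.charpoly_natDegree_eq_dim A
  have hco := Polynomial.coeff_eq_esymm_roots_of_card hcard (k := i) (by rw [hdeg]; exact hi)
  rw [hdeg, (Matrix.charpoly_monic A).leadingCoeff, one_mul] at hco
  set j := Fintype.card ι - i with hj
  have hes : IsIntegral O (A.charpoly.roots.esymm j * γ ^ j) := by
    rw [Multiset.esymm, ← Multiset.sum_map_mul_right]
    apply IsIntegral.multiset_sum
    intro y hy
    obtain ⟨t, ht, rfl⟩ := Multiset.mem_map.mp hy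
    obtain ⟨t1, t2⟩ := Multiset.mem_powersetCard.mp ht
    have : t.prod * γ ^ j = (t.map (fun x => γ * x)).prod := by
      rw [Multiset.prod_map_mul, Multiset.map_const', Multiset.prod_replicate, t2, Multiset.map_id', mul_comm]
    rw [this]
    apply IsIntegral.multiset_prod
    intro z hz
    obtain ⟨x, hx, rfl⟩ := Multiset.mem_map.mp hz
    exact hIntg x (Multiset.mem_of_le t1 hx)
  have hfin : IsIntegral O (algebraMap E L (M.charpoly.coeff i ^ N * g ^ j)) := by
    have e1 : algebraMap E L (M.charpoly.coeff i) = (-1) ^ j * A.charpoly.roots.esymm j := by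
      rw [← hco, hA, Polynomial.coeff_map]
    have : algebraMap E L (M.charpoly.coeff i ^ N * g ^ j)
        = ((-1) ^ j * (A.charpoly.roots.esymm j * γ ^ j)) ^ N := by
      rw [map_mul, map_pow, map_pow, e1, ← hγ]; ring
    rw [this]
    exact (((isIntegral_one.neg).pow j).mul hes).pow N
  exact (isIntegral_algebraMap_iff (algebraMap E L).injective).mp hfin

theorem ufd_step {B E : Type*} [CommRing B] [IsDomain B] [UniqueFactorizationMonoid B]
    [Field E] [Algebra B E] [IsFractionRing B E] (f : B) (hf : f ≠ 0) (D : ℕ) :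
    ∃ N0 : ℕ, ∀ N, N0 ≤ N → ∀ j ≤ D, ∀ e : E,
      IsIntegral B (e ^ N * (algebraMap B E f) ^ j) → ∃ b, algebraMap B E b = e := by
  classical
  letI : StrongNormalizationMonoid B := UniqueFactorizationMonoid.normalizationMonoid
  refine ⟨(UniqueFactorizationMonoid.normalizedFactors (f ^ D)).card + 1, ?_⟩
  intro N hN j hj e he
  obtain ⟨b, hb⟩ := IsIntegrallyClosed.isIntegral_iff.mp he
  obtain ⟨u, v, huv, hev⟩ := IsFractionRing.exists_reduced_fraction (A := B) e
  have hv0 : (v : B) ≠ 0 := nonZeroDivisors.coe_ne_zero v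
  have hv0' : algebraMap B E v ≠ 0 := by simpa using hv0
  have he' : e * algebraMap B E v = algebraMap B E u := by
    rw [← hev, IsLocalization.mk'_spec]
  have h1 : u ^ N * f ^ j = b * (v : B) ^ N := by
    apply IsFractionRing.injective B E
    simp only [map_mul, map_pow]
    rw [hb, ← he']; ring
  have h2 : (v : B) ^ N ∣ f ^ j :=
    (huv.symm.pow (m := N) (n := N)).dvd_of_dvd_mul_left ⟨b, by rw [h1, mul_comm]⟩
  by_cases hu : IsUnit (v : B)
  · obtain ⟨w, hw⟩ := hu.exists_right_inv
    refine ⟨u * w, ?_⟩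
    rw [map_mul, ← he', mul_assoc, ← map_mul, hw, map_one, mul_one]
  · exfalso
    obtain ⟨p, hp, hpv⟩ := WfDvdMonoid.exists_irreducible_factor hu hv0
    have h3 : p ^ N ∣ f ^ D := (pow_dvd_pow_of_dvd hpv N).trans (h2.trans (pow_dvd_pow f hj))
    rw [UniqueFactorizationMonoid.dvd_iff_normalizedFactors_le_normalizedFactors
      (pow_ne_zero _ hp.ne_zero) (pow_ne_zero _ hf)] at h3
    have h4 := Multiset.card_le_card h3
    rw [UniqueFactorizationMonoid.normalizedFactors_pow,
      UniqueFactorizationMonoid.normalizedFactors_irreducible hp] at h4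
    simp at h4
    rw [UniqueFactorizationMonoid.normalizedFactors_pow] at hN
    simp at hN
    omega

open WithZero in
theorem exists_degVal (σ R E : Type*) [CommRing R] [IsDomain R] [Field E]
    [Algebra (MvPolynomial σ R) E] [IsFractionRing (MvPolynomial σ R) E] :
    ∃ v : Valuation E (WithZero (Multiplicative ℤ)), ∀ p : MvPolynomial σ R, p ≠ 0 →
      v (algebraMap _ E p) = WithZero.exp (p.totalDegree : ℤ) := by
  classical
  let v0 : Valuation (MvPolynomial σ R) (WithZero (Multiplicative ℤ)) :=
    { toFun := fun p => if p = 0 then 0 else WithZero.exp (p.totalDegree : ℤ)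
      map_zero' := by simp
      map_one' := by simp
      map_mul' := by
        intro p q
        by_cases hp : p = 0
        · simp [hp]
        by_cases hq : q = 0
        · simp [hq]
        simp [hp, hq, MvPolynomial.totalDegree_mul_of_isDomain hp hq, WithZero.exp_add]
      map_add_le_max' := by
        intro p q
        by_cases hp : p = 0
        · simp [hp]
        by_cases hq : q = 0
        · simp [hq]
        by_cases hpq : p + q = 0
        · simp [hpq]
        simp only [hp, hq, hpq, if_false]
        have := MvPolynomial.totalDegree_add p q
        rcases le_max_iff.mp this with h | h
        · exact le_max_of_le_left (WithZero.exp_le_exp.mpr (by exact_mod_cast h))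
        · exact le_max_of_le_right (WithZero.exp_le_exp.mpr (by exact_mod_cast h)) }
  have hv0 : ∀ p, v0 p = if p = 0 then 0 else WithZero.exp (p.totalDegree : ℤ) := fun p => rfl
  have hS : nonZeroDivisors (MvPolynomial σ R) ≤ v0.supp.primeCompl := by
    intro p hp
    have : p ≠ 0 := nonZeroDivisors.ne_zero hp
    intro h
    have h' : v0 p = 0 := h
    rw [hv0, if_neg this] at h'
    exact WithZero.exp_ne_zero h'
  refine ⟨v0.extendToLocalization hS E, fun p hp => ?_⟩
  rw [Valuation.extendToLocalization_apply_map_apply, hv0, if_neg hp]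

section
variable {G : Type*} [Group G] {ι : Type*} [Fintype ι] [DecidableEq ι]

theorem word_int {O E : Type*} [CommRing O] [Field E] [Algebra O E] (ρ : G →* GL ι E) (S : Set G)
    (g : O) (hg : ∀ x, (x ∈ S ∨ x⁻¹ ∈ S) → ∃ P : Matrix ι ι O,
      P.map (algebraMap O E) = algebraMap O E g • (ρ x : Matrix ι ι E))
    (l : List G) (hl : ∀ x ∈ l, x ∈ S ∨ x⁻¹ ∈ S) :
    ∃ P : Matrix ι ι O,
      P.map (algebraMap O E) = algebraMap O E g ^ l.length • (ρ l.prod : Matrix ι ι E) := by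
  induction l with
  | nil => exact ⟨1, by simp⟩
  | cons x l ih =>
    obtain ⟨P, hP⟩ := ih (fun y hy => hl y (List.mem_cons_of_mem _ hy))
    obtain ⟨P', hP'⟩ := hg x (hl x List.mem_cons_self)
    refine ⟨P' * P, ?_⟩
    rw [Matrix.map_mul, hP, hP', List.prod_cons, map_mul, List.length_cons, Units.val_mul]
    rw [Matrix.smul_mul, Matrix.mul_smul, smul_smul, pow_succ']

theorem step_common {O E : Type*} [CommRing O] [Field E] [Algebra O E] (ρ : G →* GL ι E) (S : Set G)
    (hS : Subgroup.closure S = ⊤)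
    (g : O) (hg : ∀ x, (x ∈ S ∨ x⁻¹ ∈ S) → ∃ P : Matrix ι ι O,
      P.map (algebraMap O E) = algebraMap O E g • (ρ x : Matrix ι ι E))
    (N : ℕ) (hN : 0 < N) (a : G) (k : ℕ) (hk : 0 < k) (hl : N * wordLength S (a ^ k) ≤ k)
    (i : ℕ) (hi : i ≤ Fintype.card ι) :
    IsIntegral O ((ρ a : Matrix ι ι E).charpoly.coeff i ^ N *
      algebraMap O E g ^ (Fintype.card ι - i)) := by
  have hS' : ∀ x, x ∈ Subgroup.closure S := by simp [hS]
  have h1 : wordLength S (a ^ (N * k)) ≤ k := by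
    rw [mul_comm, pow_mul]
    exact (wl_pow (hS' _) N).trans hl
  obtain ⟨l, l1, l2, l3⟩ := wl_exists (hS' (a ^ (N * k)))
  obtain ⟨P, hP⟩ := word_int ρ S g hg l l2
  refine coeff_integral (ρ a : Matrix ι ι E) (algebraMap O E g) N k hN hk
    (g ^ (k - l.length) • P) ?_ i hi
  have : (g ^ (k - l.length) • P).map (algebraMap O E)
      = algebraMap O E g ^ (k - l.length) • P.map (algebraMap O E) := by
    ext x y
    simp
  rw [this, hP, smul_smul, ← pow_add, Nat.sub_add_cancel (by omega), l3, map_pow, Units.val_pow_eq_pow_val]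

theorem charpoly_const {R E : Type*} [CommRing R] [IsDomain R] [UniqueFactorizationMonoid R]
    [Field E] (t : ℕ) [Algebra (MvPolynomial (Fin t) R) E]
    [IsFractionRing (MvPolynomial (Fin t) R) E]
    (ρ : G →* GL ι E) (S : Set G) (hfin : S.Finite) (hS : Subgroup.closure S = ⊤) :
    ∃ N : ℕ, 0 < N ∧ ∀ N', N ≤ N' → ∀ a k, 0 < k → N' * wordLength S (a ^ k) ≤ k →
      ∃ q : Polynomial R, q.Monic ∧ (ρ a : Matrix ι ι E).charpoly
        = q.map ((algebraMap (MvPolynomial (Fin t) R) E).comp MvPolynomial.C) := by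
  classical
  set B := MvPolynomial (Fin t) R with hB
  set D := Fintype.card ι with hD
  have hfin' : {x | x ∈ S ∨ x⁻¹ ∈ S}.Finite := hfin.union (hfin.inv)
  let ent : Set E := ⋃ x ∈ {x | x ∈ S ∨ x⁻¹ ∈ S}, Set.range (fun p : ι × ι => (ρ x : Matrix ι ι E) p.1 p.2)
  have hent : ent.Finite := hfin'.biUnion fun x _ => Set.finite_range _
  have hmem : ∀ x, (x ∈ S ∨ x⁻¹ ∈ S) → ∀ i j, (ρ x : Matrix ι ι E) i j ∈ ent := by
    intro x hx i j
    exact Set.mem_biUnion (show x ∈ {x | x ∈ S ∨ x⁻¹ ∈ S} from hx) ⟨(i, j), rfl⟩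
  obtain ⟨f, hf⟩ := IsLocalization.exist_integer_multiples_of_finset (nonZeroDivisors B) hent.toFinset
  have hf0 : (f : B) ≠ 0 := nonZeroDivisors.coe_ne_zero f
  have hg1 : ∀ x, (x ∈ S ∨ x⁻¹ ∈ S) → ∃ P : Matrix ι ι B,
      P.map (algebraMap B E) = algebraMap B E f • (ρ x : Matrix ι ι E) := by
    intro x hx
    have : ∀ i j, ∃ b : B, algebraMap B E b = algebraMap B E f * (ρ x : Matrix ι ι E) i j := by
      intro i j
      obtain ⟨b, hb⟩ := hf _ (hent.mem_toFinset.mpr (hmem x hx i j))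
      exact ⟨b, by rw [hb, Algebra.smul_def]⟩
    choose P hP using this
    exact ⟨Matrix.of P, by ext i j; simp [hP]⟩
  obtain ⟨N1, hN1⟩ := ufd_step (E := E) (f : B) hf0 D
  obtain ⟨v, hv⟩ := exists_degVal (Fin t) R E
  obtain ⟨C, hC⟩ : ∃ C : ℕ, ∀ y ∈ ent, v y ≤ WithZero.exp (C : ℤ) := by
    have : ∀ y : E, ∃ c : ℕ, v y ≤ WithZero.exp (c : ℤ) := by
      intro y
      by_cases hy : v y = 0
      · exact ⟨0, by rw [hy]; exact zero_le⟩
      · refine ⟨(WithZero.log (v y)).toNat, ?_⟩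
        rw [← WithZero.log_le_iff_le_exp hy]
        exact Int.self_le_toNat _
    choose c hc using this
    refine ⟨hent.toFinset.sup c, fun y hy => (hc y).trans (WithZero.exp_le_exp.mpr ?_)⟩
    exact_mod_cast Finset.le_sup (f := c) (hent.mem_toFinset.mpr hy)
  refine ⟨max N1 (C * D + 1), by positivity, ?_⟩
  intro N hN a k hk hl
  have hNpos : 0 < N := by omega
  have hcoef : ∀ i, ∃ r : R, algebraMap B E (MvPolynomial.C r) = (ρ a : Matrix ι ι E).charpoly.coeff i := by
    intro i
    rcases lt_or_ge D i with hi | hi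
    · refine ⟨0, ?_⟩
      rw [map_zero, map_zero, Polynomial.coeff_eq_zero_of_natDegree_lt]
      rwa [Matrix.charpoly_natDegree_eq_dim]
    obtain ⟨b, hb⟩ := hN1 N (by omega) (D - i) (by omega) _
      (step_common ρ S hS (f : B) hg1 N hNpos a k hk hl i hi)
    suffices h : b.totalDegree = 0 by
      obtain hbc := MvPolynomial.totalDegree_eq_zero_iff_eq_C.mp h
      exact ⟨_, by rw [← hb]; exact congrArg _ hbc.symm⟩
    rcases Nat.eq_zero_or_pos t with ht | ht
    · subst ht
      rw [MvPolynomial.eq_C_of_isEmpty b, MvPolynomial.totalDegree_C]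
    by_contra hdeg
    have hb0 : b ≠ 0 := by rintro rfl; simp at hdeg
    let X0 : E := algebraMap B E (MvPolynomial.X ⟨0, ht⟩)
    have hX0 : v X0 = WithZero.exp (1 : ℤ) := by
      rw [hv _ (MvPolynomial.X_ne_zero _), MvPolynomial.totalDegree_X]; rfl
    have hvg : v ((X0 ^ C)⁻¹) = WithZero.exp (-(C : ℤ)) := by
      rw [map_inv₀, map_pow, hX0, ← WithZero.exp_nsmul, WithZero.exp_neg]; simp
    let g : v.valuationSubring := ⟨(X0 ^ C)⁻¹, by
      rw [Valuation.mem_valuationSubring_iff, hvg, ← WithZero.exp_zero, WithZero.exp_le_exp]; omega⟩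
    have hgE : algebraMap v.valuationSubring E g = (X0 ^ C)⁻¹ := rfl
    have hg2 : ∀ x, (x ∈ S ∨ x⁻¹ ∈ S) → ∃ P : Matrix ι ι v.valuationSubring,
        P.map (algebraMap v.valuationSubring E) =
          algebraMap v.valuationSubring E g • (ρ x : Matrix ι ι E) := by
      intro x hx
      refine ⟨Matrix.of fun i j => ⟨(X0 ^ C)⁻¹ * (ρ x : Matrix ι ι E) i j, ?_⟩, ?_⟩
      · rw [Valuation.mem_valuationSubring_iff, map_mul, hvg]
        calc _ ≤ WithZero.exp (-(C : ℤ)) * WithZero.exp (C : ℤ) :=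
              mul_le_mul_right (hC _ (hmem x hx i j)) _
          _ = 1 := by rw [← WithZero.exp_add]; simp
      · ext i j
        simp [hgE]
    have h3 := step_common ρ S hS g hg2 N hNpos a k hk hl i hi
    obtain ⟨y, hy⟩ := IsIntegrallyClosed.isIntegral_iff.mp h3
    have h4 : v ((ρ a : Matrix ι ι E).charpoly.coeff i ^ N * ((X0 ^ C)⁻¹) ^ (D - i)) ≤ 1 := by
      rw [← hgE, ← hy]
      exact (Valuation.mem_valuationSubring_iff _ _).mp y.2
    rw [← hb, map_mul, map_pow, map_pow, hvg, hv _ hb0, ← WithZero.exp_nsmul, ← WithZero.exp_nsmul,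
      ← WithZero.exp_add, ← WithZero.exp_zero, WithZero.exp_le_exp] at h4
    simp only [nsmul_eq_mul] at h4
    have h5 : ((D - i : ℕ) : ℤ) ≤ D := by omega
    have h6 : (1 : ℤ) ≤ b.totalDegree := by omega
    have h7 : (C : ℤ) * D + 1 ≤ N := by exact_mod_cast (le_max_right _ _).trans hN
    nlinarith [Int.natCast_nonneg C, Int.natCast_nonneg N]
  set φ := (algebraMap B E).comp (MvPolynomial.C : R →+* B) with hφ
  have hlift : (ρ a : Matrix ι ι E).charpoly ∈ Polynomial.lifts φ := by
    rw [Polynomial.lifts_iff_coeff_lifts]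
    intro i
    obtain ⟨r, hr⟩ := hcoef i
    exact ⟨r, hr⟩
  obtain ⟨q, hq, -, hmon⟩ := Polynomial.lifts_and_natDegree_eq_and_monic hlift (Matrix.charpoly_monic _)
  exact ⟨q, hmon, hq.symm⟩

end

section
variable {ι : Type*} [Fintype ι] [DecidableEq ι]

theorem finish_p {p : ℕ} [Fact p.Prime] {E : Type*} [Field E] (M : GL ι E) (φ : ZMod p →+* E)
    (q : Polynomial (ZMod p)) (hq : q.Monic) (h : (M : Matrix ι ι E).charpoly = q.map φ) :
    IsOfFinOrder M := by
  letI : Algebra (ZMod p) E := φ.toAlgebra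
  have hIntg : IsIntegral (ZMod p) (M : Matrix ι ι E) := by
    refine ⟨q, hq, ?_⟩
    have h1 := Matrix.aeval_self_charpoly (M : Matrix ι ι E)
    rw [h] at h1
    have h2 : Polynomial.aeval (M : Matrix ι ι E) (q.map (algebraMap (ZMod p) E)) = 0 := h1
    rw [Polynomial.aeval_map_algebraMap] at h2
    exact h2
  have hfg := hIntg.fg_adjoin_singleton
  have hfin : Module.Finite (ZMod p) (Algebra.adjoin (ZMod p) {(M : Matrix ι ι E)}) :=
    Module.Finite.iff_fg.mpr hfg
  have hfin2 : Finite (Algebra.adjoin (ZMod p) {(M : Matrix ι ι E)}) :=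
    Module.finite_of_finite (ZMod p)
  by_contra hM
  have hinj := injective_pow_iff_not_isOfFinOrder.mpr hM
  let f : ℕ → Algebra.adjoin (ZMod p) {(M : Matrix ι ι E)} := fun n =>
    ⟨(M : Matrix ι ι E) ^ n, pow_mem (Algebra.self_mem_adjoin_singleton _ _) n⟩
  have hf : Function.Injective f := by
    intro a b hab
    apply hinj
    apply Units.ext
    have := congrArg Subtype.val hab
    simpa [f] using this
  exact not_injective_infinite_finite f hf

theorem mahler_gap (D : ℕ) : ∃ m0 : ℝ, 1 < m0 ∧ ∀ q : Polynomial ℤ, q.Monic → q.natDegree ≤ D →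
    (q.map (Int.castRingHom ℂ)).mahlerMeasure < m0 →
      (q.map (Int.castRingHom ℂ)).mahlerMeasure = 1 := by
  have hf := Polynomial.finite_mahlerMeasure_le D 2
  have hf2 := ((hf.image fun p => (p.map (Int.castRingHom ℂ)).mahlerMeasure).subset
    (Set.inter_subset_left (t := Set.Ioi (1 : ℝ))))
  have h1 : ∀ q : Polynomial ℤ, q.Monic → 1 ≤ (q.map (Int.castRingHom ℂ)).mahlerMeasure := by
    intro q hq
    exact Polynomial.one_le_mahlerMeasure_of_ne_zero hq.ne_zero
  obtain ⟨m, hm1, hm⟩ : ∃ m : ℝ, 1 < m ∧ ∀ y ∈ ((fun p : Polynomial ℤ => (p.map (Int.castRingHom ℂ)).mahlerMeasure) ''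
      {p : Polynomial ℤ | p.natDegree ≤ D ∧ (p.map (Int.castRingHom ℂ)).mahlerMeasure ≤ ((2 : NNReal) : ℝ)})
      ∩ Set.Ioi (1 : ℝ), m ≤ y := by
    rcases Set.eq_empty_or_nonempty (((fun p : Polynomial ℤ => (p.map (Int.castRingHom ℂ)).mahlerMeasure) ''
      {p : Polynomial ℤ | p.natDegree ≤ D ∧ (p.map (Int.castRingHom ℂ)).mahlerMeasure ≤ ((2 : NNReal) : ℝ)})
      ∩ Set.Ioi (1 : ℝ)) with h | h
    · exact ⟨2, by norm_num, by rw [h]; simp⟩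
    · obtain ⟨m, hm, hmin⟩ := Set.exists_min_image _ id hf2 h
      exact ⟨m, hm.2, hmin⟩
  refine ⟨min m 2, lt_min hm1 (by norm_num), fun q hq hd hlt => ?_⟩
  by_contra hne
  have hgt : 1 < (q.map (Int.castRingHom ℂ)).mahlerMeasure := lt_of_le_of_ne (h1 q hq) (Ne.symm hne)
  have := hm _ ⟨⟨q, ⟨hd, (hlt.trans_le (min_le_right _ _)).le⟩, rfl⟩, hgt⟩
  exact absurd this (not_le.mpr (hlt.trans_le (min_le_left _ _)))

open scoped Matrix.Norms.Operator in
theorem eig_bound {G : Type*} [Group G] (ρ : G →* GL ι ℂ) (S : Set G) (hfin : S.Finite)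
    (hS : Subgroup.closure S = ⊤) :
    ∃ C : ℝ, 1 ≤ C ∧ ∀ (a : G) (k N : ℕ), 0 < k → N * wordLength S (a ^ k) ≤ k →
      ∀ x ∈ (ρ a : Matrix ι ι ℂ).charpoly.roots, ‖x‖ ^ N ≤ C := by
  have hfin' : {x | x ∈ S ∨ x⁻¹ ∈ S}.Finite := hfin.union (hfin.inv)
  obtain ⟨C0, hC0⟩ := (hfin'.image fun x => ‖(ρ x : Matrix ι ι ℂ)‖).bddAbove
  have hC1 : ∀ x, (x ∈ S ∨ x⁻¹ ∈ S) → ‖(ρ x : Matrix ι ι ℂ)‖ ≤ max C0 1 := fun x hx =>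
    (hC0 ⟨x, hx, rfl⟩).trans (le_max_left _ _)
  set C := max C0 1 with hC
  have hC1' : 1 ≤ C := le_max_right _ _
  refine ⟨C, hC1', fun a k N hk hl x hx => ?_⟩
  rcases isEmpty_or_nonempty ι with hι | hι
  · exfalso
    have h1 : (ρ a : Matrix ι ι ℂ).charpoly = 1 := by
      rw [Matrix.charpoly, Matrix.det_isEmpty]
    rw [h1] at hx
    simp at hx
  have hx1 : x ∈ spectrum ℂ (ρ a : Matrix ι ι ℂ) := by
    rw [Matrix.mem_spectrum_iff_isRoot_charpoly]
    exact Polynomial.isRoot_of_mem_roots hx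
  have hx2 := spectrum.pow_mem_pow (ρ a : Matrix ι ι ℂ) k hx1
  have hx3 := spectrum.norm_le_norm_of_mem hx2
  obtain ⟨l, l1, l2, l3⟩ := wl_exists (S := S) (g := a ^ k) (by simp [hS])
  have hlist : ∀ l : List G, (∀ x ∈ l, x ∈ S ∨ x⁻¹ ∈ S) →
      ‖(ρ l.prod : Matrix ι ι ℂ)‖ ≤ C ^ l.length := by
    intro l
    induction l with
    | nil => intro _; simp
    | cons y l ih =>
      intro h
      rw [List.prod_cons, map_mul, Units.val_mul, List.length_cons, pow_succ']
      refine (norm_mul_le _ _).trans ?_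
      exact mul_le_mul (hC1 y (h y List.mem_cons_self))
        (ih fun z hz => h z (List.mem_cons_of_mem _ hz)) (norm_nonneg _) (by linarith)
  have h4 := hlist l l2
  rw [l3, map_pow, Units.val_pow_eq_pow_val, l1] at h4
  have h5 : ‖x‖ ^ k ≤ C ^ wordLength S (a ^ k) := by rw [← norm_pow]; exact hx3.trans h4
  have h6 : (‖x‖ ^ N) ^ k ≤ C ^ k := by
    calc (‖x‖ ^ N) ^ k = (‖x‖ ^ k) ^ N := by rw [← pow_mul, ← pow_mul, mul_comm]
      _ ≤ (C ^ wordLength S (a ^ k)) ^ N := pow_le_pow_left₀ (by positivity) h5 N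
      _ = C ^ (N * wordLength S (a ^ k)) := by rw [← pow_mul, mul_comm]
      _ ≤ C ^ k := pow_le_pow_right₀ hC1' hl
  exact le_of_pow_le_pow_left₀ hk.ne' (by linarith) h6

theorem nilp_of_roots (A : Matrix ι ι ℂ) (h : ∀ x ∈ A.charpoly.roots, ∃ n, 0 < n ∧ x ^ n = 1) :
    ∃ m, 0 < m ∧ IsNilpotent (A ^ m - 1) := by
  classical
  choose! n hn hn1 using h
  let m := ∏ x ∈ A.charpoly.roots.toFinset, n x
  have hm : 0 < m := Finset.prod_pos fun x hx => hn x (Multiset.mem_toFinset.mp hx)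
  refine ⟨m, hm, A.charpoly.roots.card, ?_⟩
  have hsp : A.charpoly = (A.charpoly.roots.map fun a => Polynomial.X - Polynomial.C a).prod :=
    (IsAlgClosed.splits A.charpoly).eq_prod_roots_of_monic (Matrix.charpoly_monic A)
  have hdvd : A.charpoly ∣ (Polynomial.X ^ m - 1) ^ A.charpoly.roots.card := by
    have h1 : (A.charpoly.roots.map fun a => Polynomial.X - Polynomial.C a).prod ∣
        (A.charpoly.roots.map fun _ => (Polynomial.X ^ m - 1 : Polynomial ℂ)).prod := by
      apply Multiset.prod_dvd_prod_of_dvd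
      intro a ha
      rw [Polynomial.dvd_iff_isRoot]
      have h2 : n a ∣ m := Finset.dvd_prod_of_mem n (Multiset.mem_toFinset.mpr ha)
      obtain ⟨c, hc⟩ := h2
      simp [Polynomial.IsRoot, hc, pow_mul, hn1 a ha]
    rw [← hsp] at h1
    simpa using h1
  obtain ⟨w, hw⟩ := hdvd
  have h3 := congrArg (Polynomial.aeval A) hw
  rw [map_mul, Matrix.aeval_self_charpoly, zero_mul] at h3
  simpa using h3

theorem finish_0 {G : Type*} [Group G] {E : Type*} [Field E] (σ : E →+* ℂ) (ρ : G →* GL ι E)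
    (S : Set G) (hfin : S.Finite) (hS : Subgroup.closure S = ⊤) :
    ∃ N : ℕ, ∀ N', N ≤ N' → ∀ a k, 0 < k → N' * wordLength S (a ^ k) ≤ k →
      ∀ (φ : ℤ →+* E) (q : Polynomial ℤ), q.Monic → (ρ a : Matrix ι ι E).charpoly = q.map φ →
      ∃ m, 0 < m ∧ IsNilpotent ((ρ (a ^ m) : Matrix ι ι E) - 1) := by
  classical
  obtain ⟨C, hC1, hC⟩ := eig_bound ((Matrix.GeneralLinearGroup.map σ).comp ρ) S hfin hS
  set D := Fintype.card ι with hD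
  obtain ⟨m0, hm0, hgap⟩ := mahler_gap D
  obtain ⟨N, hN⟩ := pow_unbounded_of_one_lt (C ^ D) hm0
  refine ⟨N + 1, fun N' hN' a k hk hl φ q hq hqa => ?_⟩
  let A : Matrix ι ι ℂ := (ρ a : Matrix ι ι E).map σ
  have hA : (((Matrix.GeneralLinearGroup.map σ).comp ρ) a : Matrix ι ι ℂ) = A := by
    ext i j; simp [A]
  have hroots := hC a k N' hk hl
  rw [hA] at hroots
  have hAq : A.charpoly = q.map (Int.castRingHom ℂ) := by
    rw [Matrix.charpoly_map, hqa, Polynomial.map_map]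
    congr 1
    exact RingHom.ext_int _ _
  have hqd : q.natDegree = D := by
    rw [← hq.natDegree_map (Int.castRingHom ℂ), ← hAq, Matrix.charpoly_natDegree_eq_dim]
  have hcard : A.charpoly.roots.card = D := by
    rw [(Polynomial.splits_iff_card_roots).mp (IsAlgClosed.splits A.charpoly),
      Matrix.charpoly_natDegree_eq_dim]
  have hmm : A.charpoly.mahlerMeasure ^ N' ≤ C ^ D := by
    rw [Polynomial.mahlerMeasure_eq_leadingCoeff_mul_prod_roots,
      (Matrix.charpoly_monic A).leadingCoeff, norm_one, one_mul, ← Multiset.prod_map_pow]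
    rw [← hcard]
    have : C ^ A.charpoly.roots.card = (A.charpoly.roots.map fun _ => C).prod := by simp
    rw [this]
    refine Multiset.prod_map_le_prod_map₀ _ _ (fun x hx => by positivity) (fun x hx => ?_)
    rcases max_choice (1 : ℝ) ‖x‖ with h | h <;> rw [h]
    · simpa using hC1
    · exact hroots x hx
  have hlt : A.charpoly.mahlerMeasure < m0 := by
    by_contra hcon
    push Not at hcon
    have h1 : m0 ^ N' ≤ C ^ D := (pow_le_pow_left₀ (by linarith) hcon N').trans hmm
    have h2 : m0 ^ N ≤ m0 ^ N' := pow_le_pow_right₀ hm0.le (by omega)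
    linarith
  have hone := hgap q hq hqd.le (by rw [← hAq]; exact hlt)
  have hunit : IsUnit A := by
    have := (((Matrix.GeneralLinearGroup.map σ).comp ρ) a).isUnit
    rwa [hA] at this
  obtain ⟨m, hm, hnil⟩ := nilp_of_roots A (by
    intro x hx
    have hx0 : x ≠ 0 := by
      rintro rfl
      have h0 : (0 : ℂ) ∈ spectrum ℂ A := by
        rw [Matrix.mem_spectrum_iff_isRoot_charpoly]
        exact Polynomial.isRoot_of_mem_roots hx
      exact spectrum.zero_notMem ℂ hunit h0
    refine Polynomial.pow_eq_one_of_mahlerMeasure_eq_one hone ?_ ?_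
    · exact hx0
    · rw [hAq] at hx
      simpa [Polynomial.aroots] using hx)
  refine ⟨m, hm, ?_⟩
  have hinj : Function.Injective (RingHom.mapMatrix (m := ι) σ) := by
    intro X Y hXY
    ext i j
    exact σ.injective (congrFun (congrFun hXY i) j)
  rw [← IsNilpotent.map_iff hinj]
  rw [map_sub, map_one, map_pow, Units.val_pow_eq_pow_val, map_pow]
  exact hnil

end

theorem exists_embC (t : ℕ) {E : Type*} [Field E] [Algebra (MvPolynomial (Fin t) ℤ) E]
    [IsFractionRing (MvPolynomial (Fin t) ℤ) E] : Nonempty (E →+* ℂ) := by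
  obtain ⟨s, hs⟩ := exists_isTranscendenceBasis ℤ ℂ
  have hinf : Infinite s := by
    have h := IsAlgClosed.cardinal_eq_cardinal_transcendence_basis_of_aleph0_lt' _ hs
      (by simp) (by rw [Cardinal.mk_complex]; exact Cardinal.aleph0_lt_continuum)
    rw [Cardinal.infinite_iff, ← h, Cardinal.mk_complex]
    exact Cardinal.aleph0_le_continuum
  let em : Fin t ↪ s := Fin.valEmbedding.trans (Infinite.natEmbedding s)
  have hind : AlgebraicIndependent ℤ (fun i => ((em i : s) : ℂ)) := hs.1.comp em em.injective
  have hinj : Function.Injective (MvPolynomial.aeval (R := ℤ) (fun i => ((em i : s) : ℂ))) := hind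
  exact ⟨IsFractionRing.lift (A := MvPolynomial (Fin t) ℤ) (K := E) (L := ℂ)
    (g := (MvPolynomial.aeval (R := ℤ) (fun i => ((em i : s) : ℂ))).toRingHom) hinj⟩

theorem exists_alg_basis {R F : Type*} [CommRing R] [IsDomain R] [Field F] [Algebra R F]
    (hRF : Function.Injective (algebraMap R F)) (s : Set F) (hs : s.Finite) :
    ∃ (t : ℕ) (x : Fin t → F), AlgebraicIndependent R x ∧
      ∀ y ∈ s, IsAlgebraic (Algebra.adjoin R (Set.range x)) y := by
  obtain ⟨u, -, hu⟩ := exists_maximal_algebraicIndependent (R := R) (∅ : Set F) s (Set.empty_subset _)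
    ((algebraicIndependent_empty_iff R F).mpr hRF)
  have huf : u.Finite := hs.subset hu.prop.2
  have hfin : Finite u := huf
  obtain ⟨t, ⟨e⟩⟩ := Finite.exists_equiv_fin u
  have hr : Set.range (fun i => ((e.symm i : u) : F)) = u := by
    ext y; constructor
    · rintro ⟨i, rfl⟩; exact (e.symm i).2
    · intro hy; exact ⟨e ⟨y, hy⟩, by simp⟩
  refine ⟨t, fun i => ((e.symm i : u) : F), ?_, ?_⟩
  · have h1 : AlgebraicIndependent R ((↑) : u → F) := hu.prop.1
    exact h1.comp e.symm e.symm.injective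
  · rw [hr]
    intro y hy
    by_contra hcon
    have h2 : AlgebraicIndepOn R id (insert y u) := by
      apply AlgebraicIndepOn.insert hu.prop.1
      rw [Set.image_id]
      exact hcon
    have h3 : insert y u ⊆ u :=
      hu.2 ⟨h2, Set.insert_subset hy hu.prop.2⟩ (Set.subset_insert _ _)
    have hyu : y ∈ u := h3 (Set.mem_insert _ _)
    exact hcon (isAlgebraic_algebraMap (⟨y, Algebra.subset_adjoin hyu⟩ : Algebra.adjoin R u))

theorem nilp_unip {d : ℕ} {F : Type} [Field F] (M : GL (Fin d) F)
    (h : IsNilpotent ((M : Matrix (Fin d) (Fin d) F) - 1)) : IsUnipotent M := by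
  have h1 := (Matrix.isNilpotent_charpoly_sub_pow_of_isNilpotent h).eq_zero
  rw [sub_eq_zero, Fintype.card_fin] at h1
  have h2 := Matrix.aeval_self_charpoly ((M : Matrix (Fin d) (Fin d) F) - 1)
  rw [h1] at h2
  simpa [IsUnipotent] using h2

theorem reduce {R : Type} [CommRing R] [IsDomain R] {G : Type} [Group G] {d : ℕ} {F : Type} [Field F]
    [Algebra R F] (hRF : Function.Injective (algebraMap R F))
    (ρ : G →* GL (Fin d) F) (S : Set G) (hfin : S.Finite) (hS : Subgroup.closure S = ⊤) :
    ∃ (t n : ℕ) (ρ' : G →* GL (Fin d × Fin n) (FractionRing (MvPolynomial (Fin t) R))),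
      (∀ g, ρ' g = 1 → ρ g = 1) ∧
      (∀ g, IsNilpotent ((ρ' g : Matrix (Fin d × Fin n) (Fin d × Fin n) (FractionRing (MvPolynomial (Fin t) R))) - 1) →
        IsNilpotent ((ρ g : Matrix (Fin d) (Fin d) F) - 1)) := by
  classical
  have hfin' : {x | x ∈ S ∨ x⁻¹ ∈ S}.Finite := hfin.union (hfin.inv)
  let ent : Set F := ⋃ x ∈ {x | x ∈ S ∨ x⁻¹ ∈ S},
    Set.range (fun p : Fin d × Fin d => (ρ x : Matrix (Fin d) (Fin d) F) p.1 p.2)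
  have hent : ent.Finite := hfin'.biUnion fun x _ => Set.finite_range _
  have hmem : ∀ x, (x ∈ S ∨ x⁻¹ ∈ S) → ∀ i j, (ρ x : Matrix (Fin d) (Fin d) F) i j ∈ ent := by
    intro x hx i j
    exact Set.mem_biUnion (show x ∈ {x | x ∈ S ∨ x⁻¹ ∈ S} from hx) ⟨(i, j), rfl⟩
  obtain ⟨t, x, hx, halg⟩ := exists_alg_basis hRF ent hent
  let B := MvPolynomial (Fin t) R
  let E := FractionRing B
  have hinj : Function.Injective (MvPolynomial.aeval (R := R) x) := hx
  let j : E →+* F := IsFractionRing.lift (A := B) (K := E) (L := F)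
    (g := (MvPolynomial.aeval (R := R) x).toRingHom) hinj
  have hj : ∀ b : B, j (algebraMap B E b) = MvPolynomial.aeval x b := fun b =>
    IsFractionRing.lift_algebraMap hinj b
  letI : Algebra E F := j.toAlgebra
  have hIntg : ∀ y ∈ ent, IsIntegral E y := by
    intro y hy
    obtain ⟨p, hp0, hp⟩ := halg y hy
    let ψ : Algebra.adjoin R (Set.range x) →+* E :=
      (algebraMap B E).comp (hx.aevalEquiv.symm : Algebra.adjoin R (Set.range x) →+* B)
    have hψ : Function.Injective ψ :=
      (IsFractionRing.injective B E).comp hx.aevalEquiv.symm.injective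
    have hcomp : j.comp ψ = algebraMap (Algebra.adjoin R (Set.range x)) F := by
      ext z
      have h1 : j (ψ z) = MvPolynomial.aeval x (hx.aevalEquiv.symm z) := hj _
      rw [RingHom.comp_apply, h1, ← hx.algebraMap_aevalEquiv, AlgEquiv.apply_symm_apply]
    rw [← isAlgebraic_iff_isIntegral]
    refine ⟨p.map ψ, (Polynomial.map_ne_zero_iff hψ).mpr hp0, ?_⟩
    have h2 : (algebraMap E F).comp ψ = algebraMap (Algebra.adjoin R (Set.range x)) F := hcomp
    rw [Polynomial.aeval_def, Polynomial.eval₂_map, h2]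
    exact hp
  have : Finite ent := hent
  let K := IntermediateField.adjoin E ent
  have hfd : FiniteDimensional E K := IntermediateField.finiteDimensional_adjoin hIntg
  have hmatinj : Function.Injective (RingHom.mapMatrix (m := Fin d) (algebraMap K F)) := by
    intro X Y hXY
    ext a b
    exact congrArg Subtype.val ((algebraMap K F).injective (congrFun (congrFun hXY a) b))
  have hlift : ∀ g : G, ∃ P : Matrix (Fin d) (Fin d) K,
      RingHom.mapMatrix (algebraMap K F) P = (ρ g : Matrix (Fin d) (Fin d) F) := by
    intro g
    obtain ⟨l, l1, l2, l3⟩ := wl_exists (S := S) (g := g) (by simp [hS])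
    obtain ⟨P, hP⟩ := word_int (O := K) ρ S 1 (by
      intro x hx
      refine ⟨Matrix.of fun a b => ⟨(ρ x : Matrix (Fin d) (Fin d) F) a b,
        IntermediateField.subset_adjoin _ _ (hmem x hx a b)⟩, ?_⟩
      ext a b
      simp) l l2
    refine ⟨P, ?_⟩
    rw [l3, map_one, one_pow, one_smul] at hP
    exact hP
  choose P hP using hlift
  let ρK : G →* Matrix (Fin d) (Fin d) K :=
    { toFun := P
      map_one' := hmatinj (by rw [hP, map_one, map_one]; rfl)
      map_mul' := fun a b => hmatinj (by rw [hP, map_mul, map_mul, hP, hP]; simp) }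
  have hfree : Module.Free E K := Module.Free.of_divisionRing E K
  let n := Module.finrank E K
  let bas : Module.Basis (Fin n) E K := Module.finBasis E K
  let Φ1 : Matrix (Fin d) (Fin d) K →+* Matrix (Fin d) (Fin d) (Matrix (Fin n) (Fin n) E) :=
    RingHom.mapMatrix (m := Fin d) (Algebra.leftMulMatrix bas).toRingHom
  let Φ : Matrix (Fin d) (Fin d) K →+* Matrix (Fin d × Fin n) (Fin d × Fin n) E :=
    (Matrix.compRingEquiv (Fin d) (Fin n) E).toRingHom.comp Φ1
  have hΦ1 : Function.Injective Φ1 := by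
    intro X Y hXY
    ext a b : 2
    exact congrArg Subtype.val (Algebra.leftMulMatrix_injective bas (congrFun (congrFun hXY a) b))
  have hΦ : Function.Injective Φ := (Matrix.compRingEquiv (Fin d) (Fin n) E).injective.comp hΦ1
  let ρ' : G →* GL (Fin d × Fin n) E := ((Φ : _ →* _).comp ρK).toHomUnits
  have hρ' : ∀ g, (ρ' g : Matrix (Fin d × Fin n) (Fin d × Fin n) E) = Φ (P g) := fun g => rfl
  refine ⟨t, n, ρ', ?_, ?_⟩
  · intro g hg
    have h1 : Φ (P g) = Φ 1 := by rw [← hρ', hg, map_one]; rfl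
    apply Units.ext
    rw [← hP, hΦ h1, map_one]; rfl
  · intro g hg
    have h1 : Φ (P g - 1) = (ρ' g : Matrix (Fin d × Fin n) (Fin d × Fin n) E) - 1 := by
      rw [map_sub, map_one, hρ']
    have h2 : IsNilpotent (Φ (P g - 1)) := by rw [h1]; exact hg
    rw [IsNilpotent.map_iff hΦ] at h2
    have h3 := h2.map (RingHom.mapMatrix (m := Fin d) (algebraMap K F))
    rwa [map_sub, map_one, hP] at h3

theorem translation {G : Type} [Group G] {d : ℕ} {F : Type} [Field F] (ρ : G →* GL (Fin d) F)
    (hinj : Function.Injective ρ)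
    (hNIU : ∀ g : G, IsUnipotent (ρ g) → IsOfFinOrder (ρ g))
    (S : Set G) (hfin : S.Finite) (hS : Subgroup.closure S = ⊤) :
    ∃ N : ℕ, ∀ g : G, ¬ IsOfFinOrder g → ∀ k, k ≤ N * wordLength S (g ^ k) := by
  obtain ⟨p, hp⟩ := CharP.exists F
  rcases CharP.char_is_prime_or_zero F p with hpp | hp0
  · have : Fact p.Prime := ⟨hpp⟩
    letI : Algebra (ZMod p) F := ZMod.algebra F p
    obtain ⟨t, n, ρ', h1, h2⟩ := reduce (R := ZMod p) (algebraMap (ZMod p) F).injective ρ S hfin hS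
    obtain ⟨N, hN, h⟩ := charpoly_const (R := ZMod p) t ρ' S hfin hS
    refine ⟨N, fun g hg k => ?_⟩
    by_contra hk
    push Not at hk
    obtain ⟨q, hq, hqe⟩ := h N le_rfl g k (by omega) hk.le
    have hf := finish_p (ρ' g) _ q hq hqe
    obtain ⟨m, hm, he⟩ := isOfFinOrder_iff_pow_eq_one.mp hf
    apply hg
    refine isOfFinOrder_iff_pow_eq_one.mpr ⟨m, hm, hinj ?_⟩
    rw [map_one]
    exact h1 _ (by rw [map_pow, he])
  · subst hp0
    have : CharZero F := CharP.charP_to_charZero F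
    obtain ⟨t, n, ρ', h1, h2⟩ := reduce (R := ℤ) (algebraMap ℤ F).injective_int ρ S hfin hS
    obtain ⟨N, hN, h⟩ := charpoly_const (R := ℤ) t ρ' S hfin hS
    obtain ⟨σ⟩ := exists_embC t (E := FractionRing (MvPolynomial (Fin t) ℤ))
    obtain ⟨N2, h'⟩ := finish_0 σ ρ' S hfin hS
    refine ⟨max N N2, fun g hg k => ?_⟩
    by_contra hk
    push Not at hk
    obtain ⟨q, hq, hqe⟩ := h _ (le_max_left _ _) g k (by omega) hk.le
    obtain ⟨m, hm, hnil⟩ := h' _ (le_max_right _ _) g k (by omega) hk.le _ q hq hqe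
    have hf := hNIU _ (nilp_unip _ (h2 _ hnil))
    rw [hinj.isOfFinOrder_iff] at hf
    exact hg (hf.of_pow hm.ne')

/-- If `G` is a finitely generated NIU-linear group and `A` is a finitely generated
abelian subgroup of `G`, then `A` is undistorted in `G`: for any finite generating set
`S` of `G` and finite generating set `T` of `A` there is `c > 0` with
`l_S(a) ≥ c · l_T(a)` for all `a ∈ A`. -/
theorem stmt_15 {G : Type} [Group G] (hfg : Group.FG G)
    {d : ℕ} (hd : 0 < d) {F : Type} [Field F] (ρ : G →* GL (Fin d) F)
    (hinj : Function.Injective ρ)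
    (hNIU : ∀ g : G, IsUnipotent (ρ g) → IsOfFinOrder (ρ g))
    (A : Subgroup G) (hab : ∀ a b : G, a ∈ A → b ∈ A → a * b = b * a) (hAfg : A.FG) :
    ∀ S : Set G, S.Finite → Subgroup.closure S = ⊤ →
      ∀ T : Set G, T.Finite → T ⊆ (A : Set G) → Subgroup.closure T = A →
        ∃ c : ℝ, 0 < c ∧ ∀ a ∈ A,
          c * (wordLength T a : ℝ) ≤ (wordLength S a : ℝ) := by
  intro S hSf hS T hTf hTA hT
  obtain ⟨N, hN⟩ := translation ρ hinj hNIU S hSf hS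
  exact undist_of_translation A hab hAfg S hS T hT N hN
end

section
/- Let d be a positive integer and let G be a finitely generated subgroup of the isometry group of Euclidean space ℝ^d. Let A be a central subgroup of G isomorphic to ℤ^m for some m ≥ 1. Then there exists a finite index subgroup K of G containing A, together with a normal subgroup N of K, such that N ∩ A = {1} and K = NA; that is, K is the internal direct product of N and A, so A is a direct factor of K. -/
theorem aux_exists_complement {B : Type*} [CommGroup B] [Group.FG B] (C : Subgroup B) :
    ∃ D : Subgroup B, D ⊓ C = ⊥ ∧ (D ⊔ C).FiniteIndex := by
  obtain ⟨D, hD⟩ : ∃ D : Subgroup B, Maximal (fun D => D ⊓ C = ⊥) D := by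
    have := zorn_le_nonempty₀ {D : Subgroup B | D ⊓ C = ⊥} (fun c hc hch y hy => by
      refine ⟨sSup c, ?_, fun z hz => le_sSup hz⟩
      simp only [Set.mem_ofPred_eq]
      rw [Subgroup.eq_bot_iff_forall]
      rintro x ⟨hx1, hx2⟩
      have hx1' : x ∈ sSup c := hx1
      rw [Subgroup.mem_sSup_of_directedOn ⟨y, hy⟩ hch.directedOn] at hx1'
      obtain ⟨s, hs, hxs⟩ := hx1'
      have h1 : s ⊓ C = ⊥ := hc hs
      have : x ∈ s ⊓ C := ⟨hxs, hx2⟩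
      rw [h1] at this
      simpa using this) ⊥ (by simp)
    obtain ⟨D, _, hD⟩ := this
    exact ⟨D, hD⟩
  refine ⟨D, hD.prop, ?_⟩
  have htors : IsMulTorsion (B ⧸ (D ⊔ C)) := by
    intro q
    obtain ⟨x, rfl⟩ := QuotientGroup.mk_surjective q
    by_contra hx
    have hx' : ∀ n : ℤ, x ^ n ∈ D ⊔ C → n = 0 := by
      intro n hn
      by_contra hn0
      apply hx
      rw [isOfFinOrder_iff_zpow_eq_one]
      refine ⟨n, hn0, ?_⟩
      rw [← QuotientGroup.mk_zpow, QuotientGroup.eq_one_iff]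
      exact hn
    have hdis : (D ⊔ Subgroup.zpowers x) ⊓ C = ⊥ := by
      rw [Subgroup.eq_bot_iff_forall]
      rintro y ⟨hy1, hy2⟩
      obtain ⟨u, hu, v, hv, rfl⟩ := Subgroup.mem_sup.1 hy1
      obtain ⟨n, rfl⟩ := Subgroup.mem_zpowers_iff.1 hv
      have hn : x ^ n ∈ D ⊔ C := by
        have : x ^ n = u⁻¹ * (u * x ^ n) := by group
        rw [this]
        exact Subgroup.mul_mem_sup (inv_mem hu) hy2
      have := hx' n hn
      subst this
      have h3 : u * x ^ (0:ℤ) ∈ D ⊓ C := ⟨by simpa using hu, hy2⟩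
      rw [hD.prop] at h3
      simpa using h3
    have hle := hD.le_of_ge hdis le_sup_left
    have hxD : x ∈ D := hle (Subgroup.mem_sup_right (Subgroup.mem_zpowers x))
    have := hx' 1 (by simpa using Subgroup.mem_sup_left hxD)
    omega
  have : Finite (B ⧸ (D ⊔ C)) := CommGroup.finite_of_fg_isMulTorsion _ htors
  exact Subgroup.finiteIndex_of_finite_quotient

theorem aux_group {G : Type*} [Group G] [Group.FG G] (A : Subgroup G)
    (H : ∀ a ∈ A, a ∈ commutator G → a = 1) :
    ∃ K : Subgroup G, K.FiniteIndex ∧ A ≤ K ∧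
      ∃ N : Subgroup G, N ≤ K ∧ (∀ k ∈ K, ∀ x ∈ N, k * x * k⁻¹ ∈ N) ∧
        N ⊓ A = ⊥ ∧ ∀ k ∈ K, ∃ x ∈ N, ∃ a ∈ A, k = x * a := by
  have : Group.FG (Abelianization G) := inferInstanceAs (Group.FG (G ⧸ commutator G))
  obtain ⟨D, hD, hfin⟩ := aux_exists_complement (A.map (Abelianization.of (G := G)))
  refine ⟨(D ⊔ A.map Abelianization.of).comap Abelianization.of,
    ⟨by
      rw [Subgroup.index_comap_of_surjective _ (QuotientGroup.mk_surjective)]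
      exact hfin.index_ne_zero⟩, ?_,
    D.comap Abelianization.of, ?_, ?_, ?_, ?_⟩
  · intro a ha
    exact Subgroup.mem_sup_right (Subgroup.mem_map_of_mem _ ha)
  · exact Subgroup.comap_mono le_sup_left
  · intro k _ x hx
    simpa [Subgroup.mem_comap] using hx
  · rw [Subgroup.eq_bot_iff_forall]
    rintro a ⟨ha1, ha2⟩
    have h3 : Abelianization.of a ∈ D ⊓ A.map Abelianization.of :=
      ⟨ha1, Subgroup.mem_map_of_mem _ ha2⟩
    rw [hD, Subgroup.mem_bot] at h3
    apply H a ha2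
    rw [← Abelianization.ker_of]
    exact h3
  · intro k hk
    obtain ⟨u, hu, v, ⟨a, ha, rfl⟩, huv⟩ := Subgroup.mem_sup.1 (Subgroup.mem_comap.1 hk)
    refine ⟨k * a⁻¹, ?_, a, ha, by group⟩
    rw [Subgroup.mem_comap, map_mul, map_inv, ← huv]
    simpa using hu

theorem aux_eig_s16 {V G : Type*} [AddCommGroup V] [Module ℂ V] [FiniteDimensional ℂ V]
    [Group G] (ρ : G →* Module.End ℂ V) (a : G) (hc : a ∈ Subgroup.center G)
    (ha : a ∈ commutator G) (l : ℂ) (hl : (ρ a).HasEigenvalue l) :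
    l ^ (Module.finrank ℂ V).factorial = 1 := by
  let E := Module.End.eigenspace (ρ a) l
  have hE : ∀ g : G, ∀ x ∈ E, ρ g x ∈ E := by
    intro g x hx
    rw [Module.End.mem_eigenspace_iff] at hx ⊢
    rw [← Module.End.mul_apply, ← map_mul, ← Subgroup.mem_center_iff.1 hc g, map_mul,
      Module.End.mul_apply, hx, map_smul]
  let σ : G →* Module.End ℂ E :=
    { toFun := fun g => (ρ g).restrict (hE g)
      map_one' := by ext x; simp
      map_mul' := fun g h => by ext x; simp }
  let δ : G →* ℂˣ := ((LinearMap.det (M := E)).comp σ).toHomUnits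
  have h1 : δ a = 1 := Abelianization.commutator_subset_ker δ ha
  have h2 : LinearMap.det (σ a) = 1 := by
    have := congrArg (Units.val) h1
    simpa [δ] using this
  have h3 : σ a = l • LinearMap.id := by
    ext x
    have := Module.End.mem_eigenspace_iff.1 x.2
    simpa [σ] using this
  rw [h3, LinearMap.det_smul, LinearMap.det_id, mul_one] at h2
  have hpos : 0 < Module.finrank ℂ E := by
    rw [Module.finrank_pos_iff, Submodule.nontrivial_iff_ne_bot]
    exact hl
  obtain ⟨k, hk⟩ := Nat.dvd_factorial hpos (Submodule.finrank_le E)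
  rw [hk, pow_mul, h2, one_pow]

open scoped Matrix.Norms.L2Operator in
theorem aux_unitary {d : ℕ} {G : Type*} [Group G] (ρ : G →* Matrix (Fin d) (Fin d) ℂ) (a : G)
    (hc : a ∈ Subgroup.center G) (ha : a ∈ commutator G)
    (hu : ρ a ∈ unitary (Matrix (Fin d) (Fin d) ℂ)) : ρ a ^ d.factorial = 1 := by
  have hn : IsStarNormal (ρ a) := by
    constructor
    exact (Unitary.mem_iff.1 hu).1.trans (Unitary.mem_iff.1 hu).2.symm
  have key : ∀ l ∈ spectrum ℂ (ρ a), l ^ d.factorial = 1 := by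
    intro l hl
    let φ : Matrix (Fin d) (Fin d) ℂ ≃ₐ[ℂ] Module.End ℂ (Fin d → ℂ) := Matrix.toLinAlgEquiv'
    let σ : G →* Module.End ℂ (Fin d → ℂ) := (MonoidHomClass.toMonoidHom φ).comp ρ
    have h := aux_eig_s16 σ a hc ha l (by
        rw [Module.End.hasEigenvalue_iff_mem_spectrum]
        change l ∈ spectrum ℂ (φ (ρ a))
        rw [AlgEquiv.spectrum_eq]
        exact hl)
    simpa using h
  rw [← cfc_pow_id (R := ℂ) (ρ a) d.factorial, cfc_congr (g := fun _ => 1) key]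
  exact cfc_const_one ℂ (ρ a)

/-- linear part -/
noncomputable def auxLin (d : ℕ) :
    (EuclideanSpace ℝ (Fin d) ≃ᵢ EuclideanSpace ℝ (Fin d)) →*
      (EuclideanSpace ℝ (Fin d) ≃ₗᵢ[ℝ] EuclideanSpace ℝ (Fin d)) where
  toFun f := f.toRealLinearIsometryEquiv
  map_one' := by ext1 x; simp
  map_mul' f g := by
    ext1 x
    have h := map_sub f.toRealLinearIsometryEquiv (g x) (g 0)
    simp only [IsometryEquiv.toRealLinearIsometryEquiv_apply] at h
    simp only [LinearIsometryEquiv.coe_mul, Function.comp,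
      IsometryEquiv.toRealLinearIsometryEquiv_apply, IsometryEquiv.mul_apply]
    rw [h]; abel

theorem auxLin_apply {d : ℕ} (f : EuclideanSpace ℝ (Fin d) ≃ᵢ EuclideanSpace ℝ (Fin d))
    (x : EuclideanSpace ℝ (Fin d)) : auxLin d f x = f x - f 0 :=
  f.toRealLinearIsometryEquiv_apply x

/-- complex matrix of a linear isometry -/
noncomputable def auxMat (d : ℕ) :
    (EuclideanSpace ℝ (Fin d) ≃ₗᵢ[ℝ] EuclideanSpace ℝ (Fin d)) →*
      Matrix (Fin d) (Fin d) ℂ :=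
  (MonoidHomClass.toMonoidHom
    (Complex.ofRealHom.mapMatrix : Matrix (Fin d) (Fin d) ℝ →+* Matrix (Fin d) (Fin d) ℂ)).comp <|
  (MonoidHomClass.toMonoidHom (Matrix.toEuclideanCLM (n := Fin d) (𝕜 := ℝ)).symm).comp <|
  (unitary (EuclideanSpace ℝ (Fin d) →L[ℝ] EuclideanSpace ℝ (Fin d))).subtype.comp
    (MonoidHomClass.toMonoidHom
      (Unitary.linearIsometryEquiv (𝕜 := ℝ) (H := EuclideanSpace ℝ (Fin d))).symm)

theorem auxMat_inj (d : ℕ) : Function.Injective (auxMat d) := by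
  intro f g h
  have h1 := Matrix.map_injective Complex.ofReal_injective h
  have h2 := (Matrix.toEuclideanCLM (n := Fin d) (𝕜 := ℝ)).symm.injective h1
  exact (Unitary.linearIsometryEquiv (𝕜 := ℝ) (H := EuclideanSpace ℝ (Fin d))).symm.injective
    (Subtype.ext h2)

theorem auxMat_unitary (d : ℕ) (f) : auxMat d f ∈ unitary (Matrix (Fin d) (Fin d) ℂ) := by
  have h := ((Unitary.linearIsometryEquiv (𝕜 := ℝ) (H := EuclideanSpace ℝ (Fin d))).symm f).2
  have h2 := Unitary.map_mem (Matrix.toEuclideanCLM (n := Fin d) (𝕜 := ℝ)).symm h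
  have hstar : ∀ M : Matrix (Fin d) (Fin d) ℝ,
      star (Complex.ofRealHom.mapMatrix M) = Complex.ofRealHom.mapMatrix (star M) := by
    intro M
    ext i j
    simp [Matrix.star_apply]
  rw [Unitary.mem_iff] at h2 ⊢
  change star (Complex.ofRealHom.mapMatrix _) * (Complex.ofRealHom.mapMatrix _) = 1 ∧
    (Complex.ofRealHom.mapMatrix _) * star (Complex.ofRealHom.mapMatrix _) = 1
  rw [hstar, ← map_mul, ← map_mul]
  exact ⟨(congrArg _ h2.1).trans (map_one _), (congrArg _ h2.2).trans (map_one _)⟩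

theorem aux_main_s16 {d : ℕ}
    (G : Subgroup (EuclideanSpace ℝ (Fin d) ≃ᵢ EuclideanSpace ℝ (Fin d)))
    (a : G) (hc : a ∈ Subgroup.center ↥G) (ha : a ∈ commutator G) :
    a ^ d.factorial = 1 := by
  let ρ : G →* Matrix (Fin d) (Fin d) ℂ := (auxMat d).comp ((auxLin d).comp G.subtype)
  have h1 : ρ a ^ d.factorial = 1 := aux_unitary ρ a hc ha (auxMat_unitary d _)
  have h2 : auxLin d ((a ^ d.factorial : G) : _ ≃ᵢ _) = 1 := by
    apply auxMat_inj d
    rw [map_one, ← h1, ← map_pow]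
    rfl
  generalize hb : a ^ d.factorial = b at h2
  have hbc : b ∈ Subgroup.center G := hb ▸ pow_mem hc _
  have hba : b ∈ commutator G := hb ▸ pow_mem ha _
  have htr : ∀ x, b.1 x = x + b.1 0 := by
    intro x
    have := auxLin_apply b.1 x
    rw [h2] at this
    simp only [LinearIsometryEquiv.coe_one, id] at this
    rw [← sub_eq_iff_eq_add]
    exact this.symm
  set v := b.1 0 with hv
  have hfix : ∀ g : G, auxLin d g.1 v = v := by
    intro g
    have h := congrArg (fun f : G => f.1 0) (Subgroup.mem_center_iff.1 hbc g)
    simp only [Subgroup.coe_mul, IsometryEquiv.mul_apply] at h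
    rw [htr (g.1 0), ← hv] at h
    rw [auxLin_apply, h]
    abel
  let τ : G →* Multiplicative ℝ :=
    { toFun := fun g => Multiplicative.ofAdd (inner ℝ (g.1 0) v)
      map_one' := by simp
      map_mul' := fun g h => by
        rw [← ofAdd_add]
        congr 1
        have e : (g * h).1 0 = g.1 0 + auxLin d g.1 (h.1 0) := by
          rw [auxLin_apply]; simp
        rw [e, inner_add_left]
        congr 1
        conv_lhs => rw [← hfix g]
        exact LinearIsometryEquiv.inner_map_map _ _ _ }
  have h3 : τ b = 1 := Abelianization.commutator_subset_ker τ hba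
  have h4 : inner ℝ v v = 0 := Multiplicative.ofAdd.injective h3
  have h5 : v = 0 := inner_self_eq_zero.1 h4
  apply Subtype.ext
  ext1 x
  rw [htr, h5]
  simp

/-- If `G` is a finitely generated group of isometries of Euclidean space `ℝ^d` and
`A ≅ ℤ^m` (`m ≥ 1`) is central in `G`, then some finite index subgroup `K` of `G`
contains `A` as a direct factor: there is `N` normal in `K` with `N ∩ A = 1` and
`K = NA`. -/
theorem stmt_16 {d : ℕ} (hd : 0 < d)
    (G : Subgroup (EuclideanSpace ℝ (Fin d) ≃ᵢ EuclideanSpace ℝ (Fin d)))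
    (hfg : G.FG) (m : ℕ) (hm : 1 ≤ m)
    (A : Subgroup ↥G) (hcentral : A ≤ Subgroup.center ↥G)
    (hiso : Nonempty (↥A ≃* Multiplicative (Fin m → ℤ))) :
    ∃ K : Subgroup ↥G, K.FiniteIndex ∧ A ≤ K ∧
      ∃ N : Subgroup ↥G, N ≤ K ∧ (∀ k ∈ K, ∀ x ∈ N, k * x * k⁻¹ ∈ N) ∧
        N ⊓ A = ⊥ ∧ ∀ k ∈ K, ∃ x ∈ N, ∃ a ∈ A, k = x * a := by
  have : Group.FG G := (Group.fg_iff_subgroup_fg G).2 hfg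
  apply aux_group
  intro a haA ha
  have h := aux_main_s16 G a (hcentral haA) ha
  obtain ⟨e⟩ := hiso
  have h1 : e ⟨a, haA⟩ ^ d.factorial = 1 := by
    rw [← map_pow, ← map_one e]
    exact congrArg e (Subtype.ext h)
  have h2 : e ⟨a, haA⟩ = 1 := by
    have h3 : d.factorial • (Multiplicative.toAdd (e ⟨a, haA⟩)) = 0 := h1
    have h4 := (smul_eq_zero.1 h3).resolve_left (Nat.factorial_ne_zero d)
    exact h4
  have h5 : (⟨a, haA⟩ : A) = 1 := e.injective (h2.trans (map_one e).symm)
  exact congrArg Subtype.val h5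
end
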